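/- Let q be an odd prime and let k ≥ 1 be an integer. For every ε > 0, the 2k-th power moment of |L'/L| at s = 1 over non-principal Dirichlet characters modulo q satisfies: ∑_{χ mod q, χ ≠ χ₀} |L'/L(1, χ)|^{2k} = (q − 2) · ∑_{m ≥ 1} (Λ^{*k}(m))² / m² + O_{ε,k}(q^{9/10 + ε}), i.e. there is a constant C = C(ε, k) such that |∑_{χ ≠ χ₀} |L'/L(1,χ)|^{2k} − (q−2) ∑_{m≥1} (Λ^{*k}(m))²/m²| ≤ C q^{9/10+ε} for all odd primes q. -/

import Mathlib

open ArithmeticFunction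

/-- `Λ^{*k}`, the `k`-fold Dirichlet convolution of the von Mangoldt function
with itself, realized as the `k`-th power of `Λ` in the ring of arithmetic
functions (whose multiplication is Dirichlet convolution). -/
noncomputable def vonMangoldtConv (k : ℕ) : ArithmeticFunction ℝ := vonMangoldt ^ k

/-- `M_k = ∑_{m ≥ 1} (Λ^{*k}(m))² / m²`. -/
noncomputable def momentConst (k : ℕ) : ℝ :=
  ∑' m : ℕ, (vonMangoldtConv k m) ^ 2 / (m : ℝ) ^ 2

/-- `∑_{χ mod q, χ ≠ χ₀} |L'/L(1, χ)|^{2k}`, the `2k`-th power moment of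
`|L'/L(1,·)|` over the non-principal Dirichlet characters modulo `q`
(defined to be `0` for `q < 2`). -/
noncomputable def charMomentSum (q k : ℕ) : ℝ :=
  if h : 2 ≤ q then by
    haveI : NeZero q := ⟨by omega⟩
    exact ∑ χ : DirichletCharacter ℂ q,
      if χ ≠ 1 then
        ‖logDeriv (DirichletCharacter.LFunction χ) 1‖ ^ (2 * k)
      else 0
  else 0

namespace MomentProof
open Finset Filter Topology

lemma norm_sum_range_char_le {q : ℕ} [NeZero q] (χ : DirichletCharacter ℂ q) (hχ : χ ≠ 1) (n : ℕ) :
    ‖∑ k ∈ range n, χ (k : ZMod q)‖ ≤ q := by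
  induction n using Nat.strong_induction_on with
  | _ n ih =>
    rcases lt_or_ge n q with h | h
    · calc ‖∑ k ∈ range n, χ (k : ZMod q)‖ ≤ ∑ k ∈ range n, ‖χ (k : ZMod q)‖ := norm_sum_le _ _
        _ ≤ ∑ k ∈ range n, (1 : ℝ) := sum_le_sum fun k _ => χ.norm_le_one _
        _ = n := by simp
        _ ≤ q := by exact_mod_cast h.le
    · obtain ⟨m, rfl⟩ := Nat.exists_eq_add_of_le h
      have hq : 0 < q := Nat.pos_of_ne_zero (NeZero.ne q)
      rw [sum_range_add]
      have h0 : ∑ k ∈ range q, χ (k : ZMod q) = 0 := by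
        have h1 := MulChar.sum_eq_zero_of_ne_one hχ
        rw [← h1]
        obtain ⟨r, rfl⟩ : ∃ r, q = r + 1 := ⟨q - 1, by omega⟩
        rw [Finset.sum_range]
        refine Finset.sum_congr rfl fun a _ => ?_
        congr 1
        exact Fin.cast_val_eq_self a
      rw [h0, zero_add]
      simpa using ih m (by omega)

lemma norm_cpow_sub_le {s : ℂ} (hs : 0 < s.re) (n : ℕ) (hn : 0 < n) :
    ‖(n : ℂ) ^ (-s) - ((n + 1 : ℕ) : ℂ) ^ (-s)‖ ≤
      ‖s‖ / s.re * ((n : ℝ) ^ (-s.re) - ((n + 1 : ℕ) : ℝ) ^ (-s.re)) := by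
  have hn' : (0 : ℝ) < n := by exact_mod_cast hn
  have hs0 : s ≠ 0 := by rintro rfl; simp at hs
  have hnot : (0 : ℝ) ∉ Set.uIcc (n : ℝ) ((n + 1 : ℕ) : ℝ) := by
    rw [Set.uIcc_of_le (by push_cast; linarith)]
    intro h; linarith [h.1]
  have h1 := integral_cpow (a := (n : ℝ)) (b := ((n + 1 : ℕ) : ℝ)) (r := -s - 1)
    (Or.inr ⟨by intro h; apply hs0; linear_combination -h, hnot⟩)
  have h2 := integral_rpow (a := (n : ℝ)) (b := ((n + 1 : ℕ) : ℝ)) (r := -s.re - 1)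
    (Or.inr ⟨by intro h; linarith, hnot⟩)
  have e1 : (n : ℂ) ^ (-s) - ((n + 1 : ℕ) : ℂ) ^ (-s) =
      s * ∫ x in (n : ℝ)..((n + 1 : ℕ) : ℝ), (x : ℂ) ^ (-s - 1) := by
    rw [h1]; simp only [sub_add_cancel]
    field_simp
    push_cast
    ring
  have e2 : ‖s‖ / s.re * ((n : ℝ) ^ (-s.re) - ((n + 1 : ℕ) : ℝ) ^ (-s.re)) =
      ‖s‖ * ∫ x in (n : ℝ)..((n + 1 : ℕ) : ℝ), x ^ (-s.re - 1) := by
    rw [h2]; simp only [sub_add_cancel]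
    field_simp
    ring
  rw [e1, e2, norm_mul]
  gcongr
  have hle : (n : ℝ) ≤ ((n + 1 : ℕ) : ℝ) := by push_cast; linarith
  refine (intervalIntegral.norm_integral_le_integral_norm hle).trans (le_of_eq ?_)
  refine intervalIntegral.integral_congr fun x hx => ?_
  rw [Set.uIcc_of_le hle] at hx
  have hx0 : 0 < x := lt_of_lt_of_le hn' hx.1
  simp [Complex.norm_cpow_eq_rpow_re_of_pos hx0]

lemma abel_Ioc (a f : ℕ → ℂ) (M N : ℕ) (h : M ≤ N) :
    ∑ n ∈ Ioc M N, a n * f n =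
      (∑ k ∈ range (N + 1), a k) * f (N + 1) - (∑ k ∈ range (M + 1), a k) * f (M + 1)
      + ∑ n ∈ Ioc M N, (∑ k ∈ range (n + 1), a k) * (f n - f (n + 1)) := by
  induction N, h using Nat.le_induction with
  | base => simp
  | succ N h ih =>
    rw [← Finset.insert_Ioc_right_eq_Ioc_add_one h, sum_insert (by simp), sum_insert (by simp), ih,
      sum_range_succ _ (N + 1)]
    ring

lemma telescope_Ioc (f : ℕ → ℝ) (M N : ℕ) (h : M ≤ N) :
    ∑ n ∈ Ioc M N, (f n - f (n + 1)) = f (M + 1) - f (N + 1) := by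
  induction N, h using Nat.le_induction with
  | base => simp
  | succ N h ih =>
    rw [← Finset.insert_Ioc_right_eq_Ioc_add_one h, sum_insert (by simp), ih]
    ring

/-- partial sums of the Dirichlet series -/
noncomputable def SN {q : ℕ} (χ : DirichletCharacter ℂ q) (N : ℕ) (s : ℂ) : ℂ :=
  ∑ n ∈ Ioc 0 N, χ (n : ZMod q) * (n : ℂ) ^ (-s)

lemma SN_sub {q : ℕ} [NeZero q] (χ : DirichletCharacter ℂ q) (hχ : χ ≠ 1) {s : ℂ} (hs : 0 < s.re)
    (M N : ℕ) (h : M ≤ N) :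
    ‖SN χ N s - SN χ M s‖ ≤ 3 * q * (‖s‖ / s.re) * ((M + 1 : ℕ) : ℝ) ^ (-s.re) := by
  have e : SN χ N s - SN χ M s = ∑ n ∈ Ioc M N, χ (n : ZMod q) * (n : ℂ) ^ (-s) := by
    unfold SN
    rw [← Finset.Ioc_union_Ioc_eq_Ioc (Nat.zero_le M) h, sum_union]
    · ring
    · exact Finset.Ioc_disjoint_Ioc_of_le le_rfl
  rw [e, abel_Ioc (fun n => χ (n : ZMod q)) (fun n => (n : ℂ) ^ (-s)) M N h]
  have hq : (0 : ℝ) ≤ q := by positivity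
  have hr : 1 ≤ ‖s‖ / s.re := by
    rw [one_le_div hs]; exact Complex.re_le_norm s
  have nn : ∀ n : ℕ, ‖((n + 1 : ℕ) : ℂ) ^ (-s)‖ = ((n + 1 : ℕ) : ℝ) ^ (-s.re) := fun n => by
    rw [Complex.norm_natCast_cpow_of_pos (Nat.succ_pos n), Complex.neg_re]
  set X := ((M + 1 : ℕ) : ℝ) ^ (-s.re) with hX
  have hX0 : 0 ≤ X := by positivity
  have hN0 : 0 ≤ ((N + 1 : ℕ) : ℝ) ^ (-s.re) := by positivity
  have hNX : ((N + 1 : ℕ) : ℝ) ^ (-s.re) ≤ X := by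
    rw [hX]
    apply Real.rpow_le_rpow_of_nonpos (by positivity) (by exact_mod_cast Nat.succ_le_succ h)
    linarith
  have b1 : ‖(∑ k ∈ range (N + 1), χ (k : ZMod q)) * ((N + 1 : ℕ) : ℂ) ^ (-s)‖ ≤ q * X := by
    rw [norm_mul, nn]
    exact mul_le_mul (norm_sum_range_char_le χ hχ _) hNX hN0 hq
  have b2 : ‖(∑ k ∈ range (M + 1), χ (k : ZMod q)) * ((M + 1 : ℕ) : ℂ) ^ (-s)‖ ≤ q * X := by
    rw [norm_mul, nn]
    exact mul_le_mul (norm_sum_range_char_le χ hχ _) le_rfl hX0 hq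
  have b3 : ‖∑ n ∈ Ioc M N, (∑ k ∈ range (n + 1), χ (k : ZMod q)) *
      ((n : ℂ) ^ (-s) - ((n + 1 : ℕ) : ℂ) ^ (-s))‖ ≤ q * (‖s‖ / s.re) * X := by
    calc _ ≤ ∑ n ∈ Ioc M N, ‖(∑ k ∈ range (n + 1), χ (k : ZMod q)) *
        ((n : ℂ) ^ (-s) - ((n + 1 : ℕ) : ℂ) ^ (-s))‖ := norm_sum_le _ _
      _ ≤ ∑ n ∈ Ioc M N, q * (‖s‖ / s.re) * ((fun n : ℕ => (n : ℝ) ^ (-s.re)) n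
            - (fun n : ℕ => (n : ℝ) ^ (-s.re)) (n + 1)) := by
          refine sum_le_sum fun n hn => ?_
          rw [norm_mul, mul_assoc]
          have hn0 : 0 < n := by have := (mem_Ioc.1 hn).1; omega
          exact mul_le_mul (norm_sum_range_char_le χ hχ _) (norm_cpow_sub_le hs n hn0)
            (norm_nonneg _) hq
      _ = q * (‖s‖ / s.re) * (X - ((N + 1 : ℕ) : ℝ) ^ (-s.re)) := by
          rw [← mul_sum, telescope_Ioc _ M N h]
      _ ≤ _ := by
          gcongr; linarith
  calc _ ≤ q * X + q * X + q * (‖s‖ / s.re) * X :=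
        (norm_add_le _ _).trans (add_le_add ((norm_sub_le _ _).trans (add_le_add b1 b2)) b3)
    _ ≤ _ := by nlinarith [mul_nonneg hq hX0]

lemma SN_differentiable {q : ℕ} (χ : DirichletCharacter ℂ q) (N : ℕ) :
    Differentiable ℂ (SN χ N) := by
  unfold SN
  refine Differentiable.fun_sum fun n hn => ?_
  have : (n : ℂ) ≠ 0 := by
    have := (mem_Ioc.1 hn).1
    exact_mod_cast this.ne'
  intro s
  refine DifferentiableAt.const_mul ?_ _
  exact (DifferentiableAt.const_cpow (by fun_prop) (Or.inl this))

lemma SN_tendsto {q : ℕ} [NeZero q] (χ : DirichletCharacter ℂ q) (hχ : χ ≠ 1) :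
    ∀ s : ℂ, 0 < s.re → Tendsto (fun N => SN χ N s) atTop (𝓝 (DirichletCharacter.LFunction χ s)) := by
  have hz : ∀ s : ℂ, 0 < s.re → Tendsto (fun N : ℕ =>
      3 * q * (‖s‖ / s.re) * ((N + 1 : ℕ) : ℝ) ^ (-s.re)) atTop (𝓝 0) := by
    intro s hs
    have := ((tendsto_rpow_neg_atTop hs).comp (tendsto_natCast_atTop_atTop.comp
      (tendsto_add_atTop_nat 1))).const_mul (3 * q * (‖s‖ / s.re))
    simpa using this
  have hlim : ∀ s : ℂ, ∃ G, 0 < s.re → Tendsto (fun N => SN χ N s) atTop (𝓝 G) := by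
    intro s
    by_cases hs : 0 < s.re
    · have hc : CauchySeq (fun N => SN χ N s) := by
        refine cauchySeq_of_le_tendsto_0' (fun N : ℕ =>
          3 * q * (‖s‖ / s.re) * ((N + 1 : ℕ) : ℝ) ^ (-s.re)) ?_ (hz s hs)
        intro n m hnm
        rw [dist_comm, dist_eq_norm]
        exact SN_sub χ hχ hs n m hnm
      obtain ⟨G, hG⟩ := cauchySeq_tendsto_of_complete hc
      exact ⟨G, fun _ => hG⟩
    · exact ⟨0, fun h => absurd h hs⟩
  choose G hG using hlim
  have hbd : ∀ s : ℂ, 0 < s.re → ∀ N : ℕ, ‖G s - SN χ N s‖ ≤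
      3 * q * (‖s‖ / s.re) * ((N + 1 : ℕ) : ℝ) ^ (-s.re) := by
    intro s hs N
    have := ((hG s hs).sub_const (SN χ N s)).norm
    refine le_of_tendsto this ?_
    filter_upwards [eventually_ge_atTop N] with m hm
    exact SN_sub χ hχ hs N m hm
  set U : Set ℂ := {s | 0 < s.re} with hU
  have hUo : IsOpen U := isOpen_lt continuous_const Complex.continuous_re
  have hloc : TendstoLocallyUniformlyOn (fun N s => SN χ N s) G atTop U := by
    rw [Metric.tendstoLocallyUniformlyOn_iff]
    intro ε hε s hs
    have hs : 0 < s.re := hs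
    have hV : {z : ℂ | s.re / 2 < z.re ∧ ‖z‖ < ‖s‖ + 1} ∈ 𝓝[U] s := by
      refine mem_nhdsWithin_of_mem_nhds (IsOpen.mem_nhds ?_ ?_)
      · exact (isOpen_lt continuous_const Complex.continuous_re).inter
          (isOpen_lt continuous_norm continuous_const)
      · exact ⟨by linarith, by linarith⟩
    refine ⟨_, hV, ?_⟩
    have ht : Tendsto (fun N : ℕ => 3 * q * ((‖s‖ + 1) / (s.re / 2)) *
        ((N + 1 : ℕ) : ℝ) ^ (-(s.re / 2))) atTop (𝓝 0) := by
      have := ((tendsto_rpow_neg_atTop (half_pos hs)).comp (tendsto_natCast_atTop_atTop.comp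
        (tendsto_add_atTop_nat 1))).const_mul (3 * q * ((‖s‖ + 1) / (s.re / 2)))
      simpa using this
    filter_upwards [ht.eventually_lt_const hε] with N hN z hz'
    have hz0 : 0 < z.re := by linarith [hz'.1]
    rw [dist_eq_norm]
    refine (hbd z hz0 N).trans_lt (lt_of_le_of_lt ?_ hN)
    have h1 := hz'.1
    have h2 := hz'.2.le
    gcongr
    · exact_mod_cast Nat.succ_le_succ (Nat.zero_le N)
  have hGd : DifferentiableOn ℂ G U :=
    hloc.differentiableOn (Eventually.of_forall fun N => (SN_differentiable χ N).differentiableOn) hUo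
  have hLd : DifferentiableOn ℂ (DirichletCharacter.LFunction χ) U :=
    (DirichletCharacter.differentiable_LFunction hχ).differentiableOn
  have heq1 : ∀ s : ℂ, 1 < s.re → G s = DirichletCharacter.LFunction χ s := by
    intro s hs
    have hs0 : s ≠ 0 := by rintro rfl; simp at hs; linarith
    refine tendsto_nhds_unique (hG s (by linarith)) ?_
    rw [DirichletCharacter.LFunction_eq_LSeries χ hs]
    have h := (DirichletCharacter.LSeriesSummable_of_one_lt_re χ hs).LSeriesHasSum
    have h2 := (h.tendsto_sum_nat).comp (tendsto_add_atTop_nat 1)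
    refine h2.congr fun N => ?_
    unfold SN
    simp only [Function.comp]
    rw [Finset.sum_range_succ', LSeries.term_zero, add_zero]
    refine Finset.sum_nbij (fun n => n + 1) ?_ ?_ ?_ ?_
    · intro n hn
      simp only [Finset.mem_range, Finset.mem_Ioc] at *
      omega
    · intro a _ b _ hab
      simpa using hab
    · intro n hn
      simp only [Finset.coe_Ioc, Set.mem_Ioc] at hn
      exact ⟨n - 1, by simp only [Finset.coe_range, Set.mem_Iio]; omega, by simp only; omega⟩
    · intro n _
      rw [LSeries.term_of_ne_zero (Nat.succ_ne_zero n), Complex.cpow_neg, div_eq_mul_inv]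
  have heq : Set.EqOn G (DirichletCharacter.LFunction χ) U := by
    refine AnalyticOnNhd.eqOn_of_preconnected_of_eventuallyEq (hGd.analyticOnNhd hUo)
      (hLd.analyticOnNhd hUo) ?_ (z₀ := 2) (by simp [hU]) ?_
    · exact (convex_halfSpace_re_gt 0).isPreconnected
    · have : {s : ℂ | 1 < s.re} ∈ 𝓝 (2 : ℂ) :=
        (isOpen_lt continuous_const Complex.continuous_re).mem_nhds (by simp)
      filter_upwards [this] with s hs using heq1 s hs
  intro s hs
  rw [← heq hs]
  exact hG s hs

lemma L_sub_SN {q : ℕ} [NeZero q] (χ : DirichletCharacter ℂ q) (hχ : χ ≠ 1) {s : ℂ} (hs : 0 < s.re)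
    (N : ℕ) : ‖DirichletCharacter.LFunction χ s - SN χ N s‖ ≤
      3 * q * (‖s‖ / s.re) * ((N + 1 : ℕ) : ℝ) ^ (-s.re) := by
  have := ((SN_tendsto χ hχ s hs).sub_const (SN χ N s)).norm
  refine le_of_tendsto this ?_
  filter_upwards [eventually_ge_atTop N] with m hm
  exact SN_sub χ hχ hs N m hm

end MomentProof

namespace MomentProof
open Finset Filter Topology

lemma harm_le (N : ℕ) : ∑ n ∈ Ioc 0 N, ((n : ℝ))⁻¹ ≤ 1 + Real.log N := by
  have h := harmonic_le_one_add_log N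
  rw [harmonic_eq_sum_Icc] at h
  have e : Ioc 0 N = Icc 1 N := by ext; simp; omega
  rw [e]
  push_cast at h
  exact h

/-- logs are subpolynomial -/
lemma log_le_pow (η : ℝ) (hη : 0 < η) (k : ℕ) (A : ℝ) (hA : 0 ≤ A) :
    ∃ C : ℝ, 0 < C ∧ ∀ x : ℝ, 1 ≤ x → (1 + A * Real.log x) ^ k ≤ C * x ^ η := by
  set δ : ℝ := η / (k + 1) with hδ
  have hδ0 : 0 < δ := by positivity
  refine ⟨(1 + A / δ) ^ k, by positivity, fun x hx => ?_⟩
  have hx0 : 0 ≤ x := by linarith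
  have h1 : Real.log x ≤ x ^ δ / δ := Real.log_le_rpow_div hx0 hδ0
  have h2 : 1 ≤ x ^ δ := Real.one_le_rpow hx hδ0.le
  have h3 : 1 + A * Real.log x ≤ (1 + A / δ) * x ^ δ := by
    have : A * Real.log x ≤ A * (x ^ δ / δ) := mul_le_mul_of_nonneg_left h1 hA
    calc _ ≤ x ^ δ + A * (x ^ δ / δ) := add_le_add h2 this
      _ = _ := by ring
  have hlog := Real.log_nonneg hx
  calc (1 + A * Real.log x) ^ k ≤ ((1 + A / δ) * x ^ δ) ^ k :=
        pow_le_pow_left₀ (by positivity) h3 k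
    _ = (1 + A / δ) ^ k * x ^ (δ * k) := by
        rw [mul_pow, Real.rpow_mul hx0, Real.rpow_natCast]
    _ ≤ _ := by
        gcongr
        rw [hδ]
        have : (k : ℝ) / (k + 1) ≤ 1 := by rw [div_le_one (by positivity)]; linarith
        calc η / (k + 1) * k = η * (k / (k + 1)) := by ring
          _ ≤ η * 1 := by gcongr
          _ = η := mul_one _

lemma L_bound (η : ℝ) (hη : 0 < η) (hη2 : η ≤ 1 / 2) :
    ∃ C : ℝ, 0 < C ∧ ∀ (q : ℕ) [NeZero q] (χ : DirichletCharacter ℂ q), χ ≠ 1 → ∀ s : ℂ,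
      ‖s - 1‖ ≤ η → ‖DirichletCharacter.LFunction χ s‖ ≤ C * (q : ℝ) ^ (3 * η) := by
  obtain ⟨C, hC0, hC⟩ := log_le_pow η hη 1 2 (by norm_num)
  refine ⟨9 + C, by positivity, fun q _ χ hχ s hs => ?_⟩
  have hq1 : (1 : ℝ) ≤ q := by exact_mod_cast Nat.one_le_iff_ne_zero.2 (NeZero.ne q)
  have hre : 1 - η ≤ s.re := by
    have := (Complex.abs_re_le_norm (s - 1)).trans hs
    rw [Complex.sub_re, Complex.one_re] at this
    linarith [(abs_le.1 this).1]
  have hre0 : 0 < s.re := by linarith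
  have hns : ‖s‖ ≤ 3 / 2 := by
    have : ‖s‖ ≤ ‖s - 1‖ + ‖(1 : ℂ)‖ := by simpa using norm_add_le (s - 1) 1
    rw [norm_one] at this; linarith
  have hrat : ‖s‖ / s.re ≤ 3 := by
    rw [div_le_iff₀ hre0]; linarith
  have htail := L_sub_SN χ hχ hre0 (q ^ 2)
  have ht2 : 3 * q * (‖s‖ / s.re) * ((q ^ 2 + 1 : ℕ) : ℝ) ^ (-s.re) ≤ 9 := by
    have h1 : ((q ^ 2 + 1 : ℕ) : ℝ) ^ (-s.re) ≤ (q : ℝ)⁻¹ := by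
      calc ((q ^ 2 + 1 : ℕ) : ℝ) ^ (-s.re) ≤ ((q : ℝ) ^ 2) ^ (-s.re) := by
            apply Real.rpow_le_rpow_of_nonpos (by positivity)
            · push_cast; linarith
            · linarith
        _ = (q : ℝ) ^ (-(2 * s.re)) := by
            rw [← Real.rpow_natCast, ← Real.rpow_mul (by positivity)]; congr 1; push_cast; ring
        _ ≤ (q : ℝ) ^ (-1 : ℝ) := by
            apply Real.rpow_le_rpow_of_exponent_le hq1; linarith
        _ = _ := Real.rpow_neg_one _
    calc 3 * q * (‖s‖ / s.re) * ((q ^ 2 + 1 : ℕ) : ℝ) ^ (-s.re) ≤ 3 * q * 3 * (q : ℝ)⁻¹ := by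
          gcongr
      _ = 9 := by field_simp; norm_num
  have hS : ‖SN χ (q ^ 2) s‖ ≤ C * (q : ℝ) ^ (3 * η) := by
    calc ‖SN χ (q ^ 2) s‖ ≤ ∑ n ∈ Ioc 0 (q ^ 2), ‖χ (n : ZMod q) * (n : ℂ) ^ (-s)‖ := norm_sum_le _ _
      _ ≤ ∑ n ∈ Ioc 0 (q ^ 2), (q : ℝ) ^ (2 * η) * (n : ℝ)⁻¹ := by
          refine sum_le_sum fun n hn => ?_
          have hn0 := (mem_Ioc.1 hn).1
          have hn1 : (1 : ℝ) ≤ n := by exact_mod_cast hn0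
          have hnq : (n : ℝ) ≤ (q : ℝ) ^ 2 := by exact_mod_cast (mem_Ioc.1 hn).2
          rw [norm_mul, Complex.norm_natCast_cpow_of_pos hn0, Complex.neg_re]
          calc _ ≤ 1 * (n : ℝ) ^ (-s.re) := by gcongr; exact χ.norm_le_one _
            _ ≤ (n : ℝ) ^ (η - 1) := by
                rw [one_mul]; apply Real.rpow_le_rpow_of_exponent_le hn1; linarith
            _ = (n : ℝ) ^ η * (n : ℝ)⁻¹ := by
                rw [Real.rpow_sub (by linarith), Real.rpow_one, div_eq_mul_inv]
            _ ≤ ((q : ℝ) ^ 2) ^ η * (n : ℝ)⁻¹ := by gcongr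
            _ = _ := by
                rw [← Real.rpow_natCast, ← Real.rpow_mul (by positivity)]; push_cast; rfl
      _ = (q : ℝ) ^ (2 * η) * ∑ n ∈ Ioc 0 (q ^ 2), (n : ℝ)⁻¹ := by rw [mul_sum]
      _ ≤ (q : ℝ) ^ (2 * η) * (C * (q : ℝ) ^ η) := by
          gcongr
          refine (harm_le _).trans ?_
          have := hC q hq1
          rw [pow_one] at this
          refine le_trans (le_of_eq ?_) this
          push_cast
          rw [Real.log_pow]; push_cast; rfl
      _ = _ := by
          rw [mul_left_comm, ← Real.rpow_add (by linarith)]; congr 2; ring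
  have h1 : 1 ≤ (q : ℝ) ^ (3 * η) := Real.one_le_rpow hq1 (by positivity)
  calc ‖DirichletCharacter.LFunction χ s‖
      = ‖(DirichletCharacter.LFunction χ s - SN χ (q ^ 2) s) + SN χ (q ^ 2) s‖ := by rw [sub_add_cancel]
    _ ≤ 9 + C * (q : ℝ) ^ (3 * η) := (norm_add_le _ _).trans (add_le_add (htail.trans ht2) hS)
    _ ≤ _ := by nlinarith

lemma L_deriv_bound (η : ℝ) (hη : 0 < η) (hη2 : η ≤ 1 / 2) :
    ∃ C : ℝ, 0 < C ∧ ∀ (q : ℕ) [NeZero q] (χ : DirichletCharacter ℂ q), χ ≠ 1 → ∀ s : ℂ,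
      ‖s - 1‖ ≤ η / 2 → ‖DirichletCharacter.LFunction χ s‖ ≤ C * (q : ℝ) ^ (3 * η) ∧
        ‖deriv (DirichletCharacter.LFunction χ) s‖ ≤ C * (q : ℝ) ^ (3 * η) := by
  obtain ⟨C, hC0, hC⟩ := L_bound η hη hη2
  refine ⟨C / (η / 2), by positivity, fun q _ χ hχ s hs => ?_⟩
  have hCC : C ≤ C / (η / 2) := by
    rw [le_div_iff₀ (by positivity)]; nlinarith
  constructor
  · refine (hC q χ hχ s (by linarith)).trans ?_
    gcongr
  · have := Complex.norm_deriv_le_of_forall_mem_sphere_norm_le (c := s) (R := η / 2)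
      (C := C * (q : ℝ) ^ (3 * η)) (f := DirichletCharacter.LFunction χ) (by positivity)
      (DirichletCharacter.differentiable_LFunction hχ).diffContOnCl ?_
    · refine this.trans (le_of_eq ?_); ring
    · intro z hz
      refine hC q χ hχ z ?_
      rw [mem_sphere_iff_norm] at hz
      calc ‖z - 1‖ = ‖(z - s) + (s - 1)‖ := by ring_nf
        _ ≤ η / 2 + η / 2 := (norm_add_le _ _).trans (by linarith)
        _ = η := by ring

lemma trivChar_bound : ∃ C : ℝ, 1 ≤ C ∧ ∀ (q : ℕ) [NeZero q], q.Prime → ∀ x : ℝ, 0 < x → x ≤ 1 →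
    ‖DirichletCharacter.LFunctionTrivChar q (1 + x)‖ ≤ C / x := by
  have hcont : ContinuousOn riemannZeta₀ (Metric.closedBall 1 1) :=
    differentiable_riemannZeta₀.continuous.continuousOn
  obtain ⟨K, hK⟩ := (isCompact_closedBall (1 : ℂ) 1).exists_bound_of_continuousOn hcont
  have hK0 : 0 ≤ K := (norm_nonneg _).trans (hK 1 (by simp))
  refine ⟨2 * (1 + K), by linarith, fun q _ hq x hx hx1 => ?_⟩
  have hne : (1 + x : ℂ) ≠ 1 := by
    intro h
    have : (x : ℂ) = 0 := by linear_combination h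
    exact hx.ne' (by exact_mod_cast this)
  rw [DirichletCharacter.LFunctionTrivChar_eq_mul_riemannZeta hne, hq.primeFactors, prod_singleton,
    riemannZeta_eq_inv_sub_add hne, norm_mul]
  have h1 : ‖1 - (q : ℂ) ^ (-(1 + x : ℂ))‖ ≤ 2 := by
    refine (norm_sub_le _ _).trans ?_
    rw [norm_one, Complex.norm_natCast_cpow_of_pos hq.pos]
    have : (q : ℝ) ^ (-(1 + x : ℂ)).re ≤ 1 := by
      apply Real.rpow_le_one_of_one_le_of_nonpos (by exact_mod_cast hq.one_lt.le)
      simp; linarith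
    linarith
  have h2 : ‖(1 + x - 1 : ℂ)⁻¹ + riemannZeta₀ (1 + x)‖ ≤ (1 + K) / x := by
    refine (norm_add_le _ _).trans ?_
    have := hK (1 + x) (by simp [abs_of_pos hx, hx1])
    rw [add_sub_cancel_left, norm_inv, Complex.norm_real, Real.norm_of_nonneg hx.le, add_div, one_div]
    have : K ≤ K / x := by rw [le_div_iff₀ hx]; nlinarith
    linarith
  calc _ ≤ 2 * ((1 + K) / x) := mul_le_mul h1 h2 (norm_nonneg _) (by norm_num)
    _ = _ := by ring

lemma lower_complex (η : ℝ) (hη : 0 < η) (hη2 : η ≤ 1 / 2) :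
    ∃ c : ℝ, 0 < c ∧ ∀ (q : ℕ) [NeZero q], q.Prime → ∀ (χ : DirichletCharacter ℂ q), χ ^ 2 ≠ 1 →
      c * (q : ℝ) ^ (-(12 * η)) ≤ ‖DirichletCharacter.LFunction χ 1‖ := by
  obtain ⟨C, hC0, hC⟩ := L_deriv_bound η hη hη2
  obtain ⟨C1, hC1, hT⟩ := trivChar_bound
  set B : ℝ := max C 1 with hB
  have hB1 : 1 ≤ B := le_max_right _ _
  set d : ℝ := η / (32 * C1 ^ 3 * B ^ 5) with hd
  have hd0 : 0 < d := by positivity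
  have hdη : d ≤ η / 32 := by
    rw [hd]
    apply div_le_div_of_nonneg_left hη.le (by norm_num)
    have : 1 ≤ C1 ^ 3 * B ^ 5 := one_le_mul_of_one_le_of_one_le (one_le_pow₀ hC1) (one_le_pow₀ hB1)
    nlinarith
  refine ⟨d * B, by positivity, fun q _ hq χ hχ2 => ?_⟩
  have hχ : χ ≠ 1 := by rintro rfl; simp at hχ2
  have hq1 : (1 : ℝ) ≤ q := by exact_mod_cast hq.one_lt.le
  have hq0 : (0 : ℝ) < q := by linarith
  set x : ℝ := d * (q : ℝ) ^ (-(15 * η)) with hx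
  have hx0 : 0 < x := by positivity
  have hxd : x ≤ d := by
    rw [hx]
    have : (q : ℝ) ^ (-(15 * η)) ≤ 1 :=
      Real.rpow_le_one_of_one_le_of_nonpos hq1 (by linarith)
    nlinarith
  by_contra hcon
  push Not at hcon
  set Q : ℝ := B * (q : ℝ) ^ (3 * η) with hQ
  have hQ0 : 0 < Q := by positivity
  have hCQ : C * (q : ℝ) ^ (3 * η) ≤ Q := by rw [hQ]; gcongr; exact le_max_left _ _
  have hL1 : ‖DirichletCharacter.LFunction χ 1‖ < x * Q := by
    refine hcon.trans_le (le_of_eq ?_)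
    rw [hx, hQ]
    have : (q : ℝ) ^ (-(12 * η)) = (q : ℝ) ^ (-(15 * η)) * (q : ℝ) ^ (3 * η) := by
      rw [← Real.rpow_add hq0]; congr 1; ring
    rw [this]; ring
  have hmv : ‖DirichletCharacter.LFunction χ (1 + x) - DirichletCharacter.LFunction χ 1‖ ≤ Q * x := by
    have := Convex.norm_image_sub_le_of_norm_deriv_le (𝕜 := ℂ) (f := DirichletCharacter.LFunction χ)
      (s := Metric.closedBall 1 (η / 2)) (C := Q) (x := 1) (y := 1 + x)
      (fun z _ => (DirichletCharacter.differentiable_LFunction hχ) z)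
      (fun z hz => ((hC q χ hχ z (by rwa [mem_closedBall_iff_norm] at hz)).2).trans hCQ)
      (convex_closedBall _ _) (by simp; linarith) (by simp [abs_of_pos hx0]; linarith)
    simpa [abs_of_pos hx0] using this
  have hLx : ‖DirichletCharacter.LFunction χ (1 + x)‖ ≤ 2 * x * Q := by
    have : ‖DirichletCharacter.LFunction χ (1 + x)‖ ≤
      ‖DirichletCharacter.LFunction χ (1 + x) - DirichletCharacter.LFunction χ 1‖ +
        ‖DirichletCharacter.LFunction χ 1‖ := by
      simpa using norm_add_le (DirichletCharacter.LFunction χ (1 + x) -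
        DirichletCharacter.LFunction χ 1) (DirichletCharacter.LFunction χ 1)
    linarith
  have hL2 : ‖DirichletCharacter.LFunction (χ ^ 2) (1 + x)‖ ≤ Q :=
    ((hC q (χ ^ 2) hχ2 (1 + x) (by simp [abs_of_pos hx0]; linarith)).1).trans hCQ
  have hprod := DirichletCharacter.norm_LFunction_product_ge_one χ hx0 0
  simp only [Complex.ofReal_zero, mul_zero, add_zero, norm_mul, norm_pow] at hprod
  have hT' := hT q hq x hx0 (by linarith)
  have : (C1 / x) ^ 3 * (2 * x * Q) ^ 4 * Q < 1 := by
    have e : (C1 / x) ^ 3 * (2 * x * Q) ^ 4 * Q = 16 * C1 ^ 3 * Q ^ 5 * x := by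
      field_simp; ring
    have e2 : Q ^ 5 * x = B ^ 5 * d := by
      rw [hQ, hx, mul_pow, ← Real.rpow_natCast ((q : ℝ) ^ (3 * η)), ← Real.rpow_mul hq0.le]
      have : (q : ℝ) ^ (3 * η * ((5 : ℕ) : ℝ)) * (q : ℝ) ^ (-(15 * η)) = 1 := by
        rw [← Real.rpow_add hq0]; push_cast
        rw [show 3 * η * 5 + -(15 * η) = 0 by ring, Real.rpow_zero]
      linear_combination B ^ 5 * d * this
    rw [e, mul_assoc (16 * C1 ^ 3), e2, hd]
    field_simp
    linarith
  have h3 : ‖DirichletCharacter.LFunctionTrivChar q (1 + x)‖ ^ 3 *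
      ‖DirichletCharacter.LFunction χ (1 + x)‖ ^ 4 * ‖DirichletCharacter.LFunction (χ ^ 2) (1 + x)‖ ≤
      (C1 / x) ^ 3 * (2 * x * Q) ^ 4 * Q := by gcongr
  linarith

end MomentProof

namespace MomentProof
open Finset Filter Topology

lemma estermann (g : ℂ → ℂ) (hg : Differentiable ℂ g) (K l β : ℝ)
    (hK : ∀ z ∈ Metric.sphere (2 : ℂ) (4 / 3), ‖g z‖ ≤ K)
    (hm : ∀ m : ℕ, -l ≤ ((-1) ^ m * iteratedDeriv m g 2).re / m.factorial)
    (h0 : 1 - l ≤ (g 2).re) (hβ : 15 / 16 ≤ β) (hβ1 : β < 1)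
    (hgβ : (g β).re ≤ l / (1 - β)) (M : ℕ) (hM : 1 ≤ M) :
    (1 - β) * (1 - 5 * K * (51 / 64 : ℝ) ^ M) ≤ l * (2 - β) ^ M := by
  set a : ℕ → ℝ := fun m => ((-1) ^ m * iteratedDeriv m g 2).re / m.factorial with ha
  set t : ℝ := 2 - β with ht
  have ht1 : 1 < t := by rw [ht]; linarith
  have ht2 : t ≤ 17 / 16 := by rw [ht]; linarith
  have hK0 : 0 ≤ K := (norm_nonneg _).trans (hK (2 + (4 / 3 : ℝ)) (by simp))
  have hsum : HasSum (fun m => a m * t ^ m) (g β).re := by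
    have h := Complex.hasSum_taylorSeries_of_entire hg 2 (β : ℂ)
    have h2 := Complex.hasSum_re h
    convert h2 using 2 with m
    have hz : ((β : ℂ) - 2) ^ m = ((t ^ m : ℝ) : ℂ) * (-1) ^ m := by
      rw [ht]; push_cast; rw [← mul_pow]; congr 1; ring
    have hw : (((m.factorial : ℂ))⁻¹ • ((β : ℂ) - 2) ^ m • iteratedDeriv m g 2) =
        ((t ^ m / m.factorial : ℝ) : ℂ) * ((-1) ^ m * iteratedDeriv m g 2) := by
      rw [hz, smul_eq_mul, smul_eq_mul]; push_cast; ring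
    rw [hw, Complex.re_ofReal_mul, ha]
    ring
  have habs : ∀ m, |a m * t ^ m| ≤ K * (51 / 64 : ℝ) ^ m := by
    intro m
    have h1 := Complex.norm_iteratedDeriv_le_of_forall_mem_sphere_norm_le (c := 2) (R := 4 / 3)
      (f := g) m (by norm_num) hg.diffContOnCl hK
    have hf : (0 : ℝ) < m.factorial := by exact_mod_cast Nat.factorial_pos m
    have h2 : |a m| ≤ K * (3 / 4 : ℝ) ^ m := by
      rw [ha]
      simp only [abs_div, abs_of_pos hf]
      rw [div_le_iff₀ hf]
      calc _ ≤ ‖(-1) ^ m * iteratedDeriv m g 2‖ := Complex.abs_re_le_norm _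
        _ = ‖iteratedDeriv m g 2‖ := by simp
        _ ≤ _ := h1
        _ = _ := by
          rw [div_eq_mul_inv, ← inv_pow]; norm_num; ring
    rw [abs_mul, abs_pow, abs_of_pos (by linarith : 0 < t)]
    calc |a m| * t ^ m ≤ K * (3 / 4 : ℝ) ^ m * (17 / 16) ^ m := by gcongr
      _ = K * (51 / 64 : ℝ) ^ m := by rw [mul_assoc, ← mul_pow]; norm_num
  have hgeo : HasSum (fun m => K * (51 / 64 : ℝ) ^ m * (51 / 64 : ℝ) ^ M)
      (K * (64 / 13) * (51 / 64 : ℝ) ^ M) := by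
    have := ((hasSum_geometric_of_lt_one (r := (51 / 64 : ℝ)) (by norm_num) (by norm_num)).mul_left K).mul_right ((51 / 64 : ℝ) ^ M)
    norm_num at this ⊢
    exact this
  have htail : -(K * (64 / 13) * (51 / 64 : ℝ) ^ M) ≤ ∑' m, a (m + M) * t ^ (m + M) := by
    rw [← hgeo.tsum_eq, ← tsum_neg]
    refine Summable.tsum_le_tsum ?_ hgeo.summable.neg ((summable_nat_add_iff M).2 hsum.summable)
    intro m
    have := (abs_le.1 (habs (m + M))).1
    refine le_trans (le_of_eq ?_) this
    rw [pow_add]; ring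
  have hsplit := hsum.summable.sum_add_tsum_nat_add M
  rw [hsum.tsum_eq] at hsplit
  have hhead : 1 - l * ((t ^ M - 1) / (t - 1)) ≤ ∑ m ∈ range M, a m * t ^ m := by
    rw [← geom_sum_eq ht1.ne' M]
    obtain ⟨M', rfl⟩ : ∃ M', M = M' + 1 := ⟨M - 1, by omega⟩
    rw [sum_range_succ', sum_range_succ', mul_add]
    have h1 : -(l * ∑ k ∈ range M', t ^ (k + 1)) ≤ ∑ k ∈ range M', a (k + 1) * t ^ (k + 1) := by
      rw [mul_sum, ← sum_neg_distrib]
      refine sum_le_sum fun k _ => ?_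
      have := hm (k + 1)
      have htp : 0 ≤ t ^ (k + 1) := by positivity
      calc -(l * t ^ (k + 1)) = -l * t ^ (k + 1) := by ring
        _ ≤ _ := mul_le_mul_of_nonneg_right this htp
    have h2 : a 0 = (g 2).re := by simp [ha]
    rw [h2]
    simp only [pow_zero, mul_one]
    linarith
  have ht3 : t - 1 = 1 - β := by rw [ht]; ring
  rw [ht3] at hhead
  have hβ0 : 0 < 1 - β := by linarith
  have hfin : 1 - l * ((t ^ M - 1) / (1 - β)) - K * (64 / 13) * (51 / 64 : ℝ) ^ M ≤ l / (1 - β) := by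
    linarith
  have h5 : K * (64 / 13) * (51 / 64 : ℝ) ^ M ≤ 5 * K * (51 / 64 : ℝ) ^ M := by
    have : 0 ≤ K * (51 / 64 : ℝ) ^ M := by positivity
    nlinarith
  have h6 : 1 - 5 * K * (51 / 64 : ℝ) ^ M ≤ l * t ^ M / (1 - β) := by
    have : l * t ^ M / (1 - β) = l * ((t ^ M - 1) / (1 - β)) + l / (1 - β) := by ring
    linarith
  rw [le_div_iff₀ hβ0] at h6
  linarith

/-- The derivation `f ↦ f · log`. -/
noncomputable def Dl (f : ArithmeticFunction ℂ) : ArithmeticFunction ℂ :=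
  ⟨fun n => f n * (Real.log n : ℂ), by simp⟩

lemma Dl_apply (f : ArithmeticFunction ℂ) (n : ℕ) : Dl f n = f n * (Real.log n : ℂ) := rfl

lemma Dl_mul (f g : ArithmeticFunction ℂ) : Dl (f * g) = Dl f * g + f * Dl g := by
  ext n
  simp only [Dl_apply, ArithmeticFunction.add_apply, ArithmeticFunction.mul_apply]
  rw [sum_mul, ← sum_add_distrib]
  refine sum_congr rfl fun p hp => ?_
  obtain ⟨h1, h2⟩ := Nat.mem_divisorsAntidiagonal.1 hp
  have hp1 : p.1 ≠ 0 := by rintro h; simp [h] at h1; exact h2 h1.symm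
  have hp2 : p.2 ≠ 0 := by rintro h; simp [h] at h1; exact h2 h1.symm
  rw [← h1]
  push_cast
  rw [Real.log_mul (by exact_mod_cast hp1) (by exact_mod_cast hp2)]
  push_cast; ring

/-- Twist of `Λ`. -/
noncomputable def LamT {q : ℕ} (χ : DirichletCharacter ℂ q) : ArithmeticFunction ℂ :=
  ⟨fun n => χ (n : ZMod q) * (Λ n : ℂ), by simp⟩

/-- Character as an arithmetic function. -/
noncomputable def chA {q : ℕ} (χ : DirichletCharacter ℂ q) : ArithmeticFunction ℂ :=
  ⟨fun n => if n = 0 then 0 else χ (n : ZMod q), by simp⟩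

lemma LamT_apply {q : ℕ} (χ : DirichletCharacter ℂ q) (n : ℕ) :
    LamT χ n = χ (n : ZMod q) * (Λ n : ℂ) := rfl

lemma chA_apply {q : ℕ} (χ : DirichletCharacter ℂ q) (n : ℕ) :
    chA χ n = if n = 0 then 0 else χ (n : ZMod q) := rfl

lemma Dl_chA {q : ℕ} (χ : DirichletCharacter ℂ q) : Dl (chA χ) = chA χ * LamT χ := by
  ext n
  simp only [Dl_apply, ArithmeticFunction.mul_apply, chA_apply, LamT_apply]
  rcases eq_or_ne n 0 with rfl | hn
  · simp
  rw [if_neg hn, ← ArithmeticFunction.vonMangoldt_sum]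
  rw [Nat.sum_divisorsAntidiagonal' (f := fun a b => (if a = 0 then 0 else χ (a : ZMod q)) *
    (χ (b : ZMod q) * (Λ b : ℂ)))]
  push_cast
  rw [mul_sum]
  refine sum_congr rfl fun d hd => ?_
  have hd' := Nat.dvd_of_mem_divisors hd
  have : n / d ≠ 0 := (Nat.div_pos (Nat.le_of_dvd (Nat.pos_of_ne_zero hn) hd')
    (Nat.pos_of_mem_divisors hd)).ne'
  rw [if_neg this, ← mul_assoc, ← map_mul, ← Nat.cast_mul, Nat.div_mul_cancel hd']

open ComplexOrder in
lemma nonneg_of_deriv (r w : ArithmeticFunction ℂ) (h1 : r 1 = 1) (hw : ∀ n, 0 ≤ w n) (hw1 : w 1 = 0)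
    (hD : Dl r = r * w) (n : ℕ) : 0 ≤ r n := by
  induction n using Nat.strong_induction_on with
  | _ n ih =>
    rcases eq_or_ne n 0 with rfl | hn
    · simp
    rcases eq_or_ne n 1 with rfl | hn1
    · rw [h1]; exact zero_le_one
    have h : r n * (Real.log n : ℂ) = (r * w) n := by rw [← hD]; rfl
    have hlog : 0 < Real.log n := Real.log_pos (by exact_mod_cast (by omega : 1 < n))
    have h2 : 0 ≤ (r * w) n := by
      rw [ArithmeticFunction.mul_apply]
      refine sum_nonneg fun p hp => ?_
      obtain ⟨hp1, _⟩ := Nat.mem_divisorsAntidiagonal.1 hp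
      rcases eq_or_ne p.2 1 with h' | h'
      · rw [h', hw1, mul_zero]
      · refine mul_nonneg (ih p.1 ?_) (hw _)
        have hp2 : p.2 ≠ 0 := by rintro h; simp [h] at hp1; exact hn hp1.symm
        have hp10 : p.1 ≠ 0 := by rintro h; simp [h] at hp1; exact hn hp1.symm
        rw [← hp1]
        exact lt_mul_of_one_lt_right (Nat.pos_of_ne_zero hp10) (by omega)
    have h3 : r n = (r * w) n * ((Real.log n)⁻¹ : ℝ) := by
      rw [← h, mul_assoc, ← Complex.ofReal_mul, mul_inv_cancel₀ hlog.ne']; simp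
    rw [h3]
    exact mul_nonneg h2 (Complex.zero_le_real.2 (inv_pos.2 hlog).le)

lemma chA_one {q : ℕ} (χ : DirichletCharacter ℂ q) : chA χ 1 = 1 := by simp [chA_apply]

lemma Dl_zeta : Dl (chA (1 : DirichletCharacter ℂ 1)) =
    chA (1 : DirichletCharacter ℂ 1) * LamT (1 : DirichletCharacter ℂ 1) := Dl_chA _

/-- The Dirichlet coefficients of `ζ(s) L(s,χ₁) L(s,χ₂) L(s,χ₃)`. -/
noncomputable def rF {a b c : ℕ} (χ₁ : DirichletCharacter ℂ a) (χ₂ : DirichletCharacter ℂ b)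
    (χ₃ : DirichletCharacter ℂ c) : ArithmeticFunction ℂ :=
  chA (1 : DirichletCharacter ℂ 1) * chA χ₁ * chA χ₂ * chA χ₃

lemma quad_val {q : ℕ} {χ : DirichletCharacter ℂ q} (h : χ ^ 2 = 1) (n : ℕ) :
    χ (n : ZMod q) = 0 ∨ χ (n : ZMod q) = 1 ∨ χ (n : ZMod q) = -1 :=
  MulChar.isQuadratic_iff_sq_eq_one.mpr h n

open ComplexOrder in
lemma rF_nonneg {a b c : ℕ} (χ₁ : DirichletCharacter ℂ a) (χ₂ : DirichletCharacter ℂ b)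
    (χ₃ : DirichletCharacter ℂ c) (h1 : χ₁ ^ 2 = 1) (h2 : χ₂ ^ 2 = 1)
    (h3 : ∀ n : ℕ, χ₃ n = χ₁ n * χ₂ n) (n : ℕ) : 0 ≤ rF χ₁ χ₂ χ₃ n := by
  refine nonneg_of_deriv _ (LamT (1 : DirichletCharacter ℂ 1) + LamT χ₁ + LamT χ₂ + LamT χ₃)
    ?_ ?_ ?_ ?_ n
  · simp [rF, ArithmeticFunction.mul_apply, chA_one]
  · intro m
    have : (LamT (1 : DirichletCharacter ℂ 1) + LamT χ₁ + LamT χ₂ + LamT χ₃) m =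
        (1 + χ₁ m) * (1 + χ₂ m) * (Λ m : ℂ) := by
      have h1 : (1 : DirichletCharacter ℂ 1) (m : ZMod 1) = 1 := by
        rw [Subsingleton.elim (m : ZMod 1) 1, map_one]
      simp only [ArithmeticFunction.add_apply, LamT_apply, h3, h1]
      ring
    rw [this]
    refine mul_nonneg (mul_nonneg ?_ ?_) (Complex.zero_le_real.2 vonMangoldt_nonneg)
    · rcases quad_val h1 m with h | h | h <;> rw [h] <;> norm_num
    · rcases quad_val h2 m with h | h | h <;> rw [h] <;> norm_num
  · simp [ArithmeticFunction.add_apply, LamT_apply]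
  · unfold rF
    simp only [Dl_mul, Dl_chA]
    ring

end MomentProof

namespace MomentProof
open Finset Filter Topology

lemma chA_summable {q : ℕ} (χ : DirichletCharacter ℂ q) {s : ℂ} (hs : 1 < s.re) :
    LSeriesSummable (fun n => chA χ n) s := by
  refine (LSeriesSummable_congr s (f := fun n : ℕ => χ (n : ZMod q)) ?_).1
    (DirichletCharacter.LSeriesSummable_of_one_lt_re χ hs)
  intro n hn
  simp [chA_apply, hn]

lemma chA_LSeries {q : ℕ} [NeZero q] (χ : DirichletCharacter ℂ q) {s : ℂ} (hs : 1 < s.re) :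
    LSeries (fun n => chA χ n) s = DirichletCharacter.LFunction χ s := by
  rw [DirichletCharacter.LFunction_eq_LSeries χ hs]
  refine LSeries_congr ?_ s
  intro n hn
  simp [chA_apply, hn]

lemma rF_summable {a b c : ℕ} (χ₁ : DirichletCharacter ℂ a) (χ₂ : DirichletCharacter ℂ b)
    (χ₃ : DirichletCharacter ℂ c) {s : ℂ} (hs : 1 < s.re) :
    LSeriesSummable (fun n => rF χ₁ χ₂ χ₃ n) s :=
  ArithmeticFunction.LSeriesSummable_mul (ArithmeticFunction.LSeriesSummable_mul
    (ArithmeticFunction.LSeriesSummable_mul (chA_summable _ hs) (chA_summable _ hs))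
    (chA_summable _ hs)) (chA_summable _ hs)

lemma rF_LSeries {a b c : ℕ} [NeZero a] [NeZero b] [NeZero c]
    (χ₁ : DirichletCharacter ℂ a) (χ₂ : DirichletCharacter ℂ b)
    (χ₃ : DirichletCharacter ℂ c) {s : ℂ} (hs : 1 < s.re) :
    LSeries (fun n => rF χ₁ χ₂ χ₃ n) s = riemannZeta s * (DirichletCharacter.LFunction χ₁ s *
      DirichletCharacter.LFunction χ₂ s * DirichletCharacter.LFunction χ₃ s) := by
  have h1 := chA_summable (1 : DirichletCharacter ℂ 1) hs
  have h2 := chA_summable χ₁ hs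
  have h3 := chA_summable χ₂ hs
  have h4 := chA_summable χ₃ hs
  have h12 := ArithmeticFunction.LSeriesSummable_mul h1 h2
  have h123 := ArithmeticFunction.LSeriesSummable_mul h12 h3
  unfold rF
  rw [ArithmeticFunction.LSeries_mul' h123 h4, ArithmeticFunction.LSeries_mul' h12 h3,
    ArithmeticFunction.LSeries_mul' h1 h2, chA_LSeries _ hs, chA_LSeries _ hs, chA_LSeries _ hs,
    chA_LSeries _ hs, DirichletCharacter.LFunction_modOne_eq]
  ring

lemma L_triv_bound {q : ℕ} [NeZero q] (χ : DirichletCharacter ℂ q) (hχ : χ ≠ 1) {s : ℂ}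
    (hs : 2 / 3 ≤ s.re) (hs2 : ‖s‖ ≤ 10 / 3) : ‖DirichletCharacter.LFunction χ s‖ ≤ 15 * q := by
  have h := L_sub_SN χ hχ (s := s) (by linarith) 0
  have h0 : SN χ 0 s = 0 := by simp [SN]
  rw [h0, sub_zero] at h
  refine h.trans ?_
  simp only [zero_add, Nat.cast_one, Real.one_rpow, mul_one]
  have : ‖s‖ / s.re ≤ 5 := by rw [div_le_iff₀ (by linarith)]; linarith
  have hq : (0 : ℝ) ≤ q := by positivity
  nlinarith

open ComplexOrder in
lemma siegel_core : ∃ K₀ : ℝ, 0 < K₀ ∧ ∀ (a b c : ℕ) [NeZero a] [NeZero b] [NeZero c]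
    (χ₁ : DirichletCharacter ℂ a) (χ₂ : DirichletCharacter ℂ b) (χ₃ : DirichletCharacter ℂ c),
    χ₁ ≠ 1 → χ₂ ≠ 1 → χ₃ ≠ 1 → χ₁ ^ 2 = 1 → χ₂ ^ 2 = 1 → (∀ n : ℕ, χ₃ n = χ₁ n * χ₂ n) →
    ∀ β : ℝ, 15 / 16 ≤ β → β < 1 →
    (riemannZeta β * (DirichletCharacter.LFunction χ₁ β * DirichletCharacter.LFunction χ₂ β *
      DirichletCharacter.LFunction χ₃ β)).re ≤ 0 → ∀ M : ℕ, 1 ≤ M →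
    (1 - β) * (1 - 5 * (K₀ * (a * b * c)) * (51 / 64 : ℝ) ^ M) ≤
      ‖DirichletCharacter.LFunction χ₁ 1 * DirichletCharacter.LFunction χ₂ 1 *
      DirichletCharacter.LFunction χ₃ 1‖ * (2 - β) ^ M := by
  obtain ⟨Z, hZ⟩ := (isCompact_sphere (2 : ℂ) (4 / 3)).exists_bound_of_continuousOn
    differentiable_riemannZeta₀.continuous.continuousOn
  have hZ0 : 0 ≤ Z := (norm_nonneg _).trans (hZ (2 + (4 / 3 : ℝ)) (by simp))
  refine ⟨3375 * (Z + 6), by positivity, ?_⟩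
  intro a b c _ _ _ χ₁ χ₂ χ₃ n1 n2 n3 q1 q2 h3 β hβ hβ1 hF M hM
  set h : ℂ → ℂ := fun s => DirichletCharacter.LFunction χ₁ s * DirichletCharacter.LFunction χ₂ s *
      DirichletCharacter.LFunction χ₃ s with hh
  have hd : Differentiable ℂ h :=
    ((DirichletCharacter.differentiable_LFunction n1).mul
      (DirichletCharacter.differentiable_LFunction n2)).mul
      (DirichletCharacter.differentiable_LFunction n3)
  set g : ℂ → ℂ := fun s => riemannZeta₀ s * h s + dslope h 1 s with hgdef
  have hgd : Differentiable ℂ g := by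
    refine (differentiable_riemannZeta₀.mul hd).add ?_
    rw [← differentiableOn_univ]
    exact (Complex.differentiableOn_dslope univ_mem).2 hd.differentiableOn
  have hgF : ∀ s : ℂ, s ≠ 1 → g s = riemannZeta s * h s - h 1 * (s - 1)⁻¹ := by
    intro s hs
    have hs' : s - 1 ≠ 0 := sub_ne_zero.2 hs
    rw [hgdef]
    simp only
    rw [dslope_of_ne _ hs, slope_def_field, riemannZeta_eq_inv_sub_add hs]
    field_simp
    ring
  have hhb : ∀ s : ℂ, 2 / 3 ≤ s.re → ‖s‖ ≤ 10 / 3 → ‖h s‖ ≤ 3375 * (a * b * c) := by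
    intro s hs hs2
    rw [hh]; simp only [norm_mul]
    calc _ ≤ (15 * a) * (15 * b) * (15 * (c : ℝ)) := by
          gcongr
          exacts [L_triv_bound _ n1 hs hs2, L_triv_bound _ n2 hs hs2, L_triv_bound _ n3 hs hs2]
      _ = _ := by ring
  have key := estermann g hgd (3375 * (Z + 6) * (a * b * c)) (h 1).re β ?_ ?_ ?_ hβ hβ1 ?_ M hM
  · refine key.trans ?_
    have : (0 : ℝ) ≤ (2 - β) ^ M := pow_nonneg (by linarith) _
    exact mul_le_mul_of_nonneg_right (Complex.re_le_norm _) this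
  · intro z hz
    have hz' : ‖z - 2‖ = 4 / 3 := by simpa [dist_eq_norm] using hz
    have hre : 2 / 3 ≤ z.re := by
      have := (abs_le.1 ((Complex.abs_re_le_norm (z - 2)).trans hz'.le)).1
      simp at this; linarith
    have hn : ‖z‖ ≤ 10 / 3 := by
      calc ‖z‖ = ‖(z - 2) + 2‖ := by ring_nf
        _ ≤ ‖z - 2‖ + ‖(2 : ℂ)‖ := norm_add_le _ _
        _ = 10 / 3 := by rw [hz']; norm_num
    have hz1 : 1 / 3 ≤ ‖z - 1‖ := by
      have : ‖z - 2‖ ≤ ‖z - 1‖ + ‖(1 : ℂ)‖ := by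
        calc ‖z - 2‖ = ‖(z - 1) - 1‖ := by ring_nf
          _ ≤ _ := norm_sub_le _ _
      rw [hz'] at this; norm_num at this; linarith
    have hne : z ≠ 1 := by rintro rfl; norm_num at hz1
    have hA := hhb z hre hn
    have hB := hhb 1 (by norm_num) (by norm_num)
    set A : ℝ := 3375 * (a * b * c) with hAd
    have hA0 : 0 ≤ A := by positivity
    have hs : ‖dslope h 1 z‖ ≤ 6 * A := by
      rw [dslope_of_ne _ hne, slope_def_field, norm_div, div_le_iff₀ (by linarith)]
      calc ‖h z - h 1‖ ≤ ‖h z‖ + ‖h 1‖ := norm_sub_le _ _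
        _ ≤ 6 * A * (1 / 3) := by linarith
        _ ≤ _ := by gcongr
    calc ‖g z‖ ≤ ‖riemannZeta₀ z‖ * ‖h z‖ + ‖dslope h 1 z‖ := by
          rw [hgdef]; simp only; rw [← norm_mul]; exact norm_add_le _ _
      _ ≤ Z * A + 6 * A := by gcongr; exact hZ z hz
      _ = _ := by rw [hAd]; ring
  · intro m
    have habs : LSeries.abscissaOfAbsConv (fun n => rF χ₁ χ₂ χ₃ n) ≤ (1 : ℝ) :=
      LSeries.abscissaOfAbsConv_le_of_forall_lt_LSeriesSummable fun y hy =>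
        rF_summable χ₁ χ₂ χ₃ (by simpa using hy)
    have habs2 : LSeries.abscissaOfAbsConv (fun n => rF χ₁ χ₂ χ₃ n) < (2 : ℝ) :=
      habs.trans_lt (by exact_mod_cast one_lt_two)
    have h0 := LSeries.iteratedDeriv_alternating (a := fun n => rF χ₁ χ₂ χ₃ n)
      (fun n => rF_nonneg χ₁ χ₂ χ₃ q1 q2 h3 n) habs2 m
    have hev : g =ᶠ[𝓝 (2 : ℂ)] fun s => LSeries (fun n => rF χ₁ χ₂ χ₃ n) s - h 1 * (s - 1)⁻¹ := by
      have ho : IsOpen {s : ℂ | 1 < s.re} := isOpen_lt continuous_const Complex.continuous_re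
      filter_upwards [ho.mem_nhds (by simp : (2 : ℂ) ∈ {s : ℂ | 1 < s.re})] with s hs
      rw [rF_LSeries _ _ _ hs, hgF s (by rintro rfl; simp at hs)]
    rw [hev.iteratedDeriv_eq]
    have hc1 : ContDiffAt ℂ m (LSeries (fun n => rF χ₁ χ₂ χ₃ n)) 2 := by
      have hA := LSeries_analyticOnNhd (fun n => rF χ₁ χ₂ χ₃ n) 2 (by simpa using habs2)
      exact hA.contDiffAt
    have hc2 : ContDiffAt ℂ m (fun s : ℂ => (s - 1)⁻¹) 2 := by
      refine ContDiffAt.inv (by fun_prop) (by norm_num)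
    have e1 : iteratedDeriv m (fun s : ℂ => LSeries (fun n => rF χ₁ χ₂ χ₃ n) s - h 1 * (s - 1)⁻¹) 2
        = iteratedDeriv m (LSeries (fun n => rF χ₁ χ₂ χ₃ n)) 2
          - h 1 * ((-1) ^ m * m.factorial) := by
      have := iteratedDeriv_sub (n := m) hc1 (contDiffAt_const (c := h 1) |>.mul hc2)
      rw [show (fun s : ℂ => LSeries (fun n => rF χ₁ χ₂ χ₃ n) s - h 1 * (s - 1)⁻¹) =
        LSeries (fun n => rF χ₁ χ₂ χ₃ n) - (fun s => h 1 * (s - 1)⁻¹) from rfl, this]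
      congr 1
      rw [iteratedDeriv_const_mul_field]
      congr 1
      have := iter_deriv_inv_linear_sub (𝕜 := ℂ) m 1 1
      rw [iteratedDeriv_eq_iterate]
      simp only [one_mul] at this
      rw [this]; norm_num
    rw [e1]
    have hf : (0 : ℝ) < m.factorial := by exact_mod_cast Nat.factorial_pos m
    rw [le_div_iff₀ hf]
    have h0' := (Complex.nonneg_iff.1 h0).1
    have : (-1) ^ m * (iteratedDeriv m (LSeries (fun n => rF χ₁ χ₂ χ₃ n)) 2
          - h 1 * ((-1) ^ m * m.factorial)) =
        (-1) ^ m * (iteratedDeriv m (LSeries (fun n => rF χ₁ χ₂ χ₃ n)) 2) -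
          h 1 * ((m.factorial : ℝ) : ℂ) := by
      have h1 : ((-1 : ℂ)) ^ m * (-1) ^ m = 1 := by rw [← mul_pow]; simp
      push_cast
      linear_combination (-(h 1) * m.factorial) * h1
    rw [this, Complex.sub_re, Complex.re_mul_ofReal]
    simp only [Complex.ofReal_ofNat] at h0'
    linarith
  · rw [hgF 2 (by norm_num)]
    have h1 : (1 : ℝ) < (2 : ℂ).re := by simp
    rw [hh, ← rF_LSeries χ₁ χ₂ χ₃ h1]
    have hsum := rF_summable χ₁ χ₂ χ₃ h1
    have h2 : 1 ≤ (LSeries (fun n => rF χ₁ χ₂ χ₃ n) 2).re := by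
      rw [LSeries, Complex.re_tsum hsum]
      have hs' := (Complex.hasSum_re hsum.hasSum).summable
      refine le_trans (le_of_eq ?_) (hs'.le_tsum 1 ?_)
      · simp [LSeries.term_def, rF, ArithmeticFunction.mul_apply, chA_one]
      · intro n _
        have h0 := LSeries.term_nonneg (a := fun n => rF χ₁ χ₂ χ₃ n) (n := n) (rF_nonneg χ₁ χ₂ χ₃ q1 q2 h3 n) 2
        simpa using (Complex.nonneg_iff.1 h0).1
    have : ((2 : ℂ) - 1)⁻¹ = 1 := by norm_num
    rw [this, mul_one, Complex.sub_re]
    simp only at h2 ⊢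
    linarith
  · have hne : (β : ℂ) ≠ 1 := by exact_mod_cast hβ1.ne
    rw [hgF _ hne, Complex.sub_re]
    have : ((β : ℂ) - 1)⁻¹ = ((-(1 - β)⁻¹ : ℝ) : ℂ) := by
      push_cast; rw [← inv_neg]; ring_nf
    rw [this, Complex.re_mul_ofReal, div_eq_mul_inv]
    rw [hh] at *
    simp only at *
    linarith

end MomentProof

namespace MomentProof
open Finset Filter Topology

lemma siegel_core2 : ∃ K₁ : ℝ, 1 ≤ K₁ ∧ ∀ (a b c : ℕ) [NeZero a] [NeZero b] [NeZero c]
    (χ₁ : DirichletCharacter ℂ a) (χ₂ : DirichletCharacter ℂ b) (χ₃ : DirichletCharacter ℂ c),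
    χ₁ ≠ 1 → χ₂ ≠ 1 → χ₃ ≠ 1 → χ₁ ^ 2 = 1 → χ₂ ^ 2 = 1 → (∀ n : ℕ, χ₃ n = χ₁ n * χ₂ n) →
    ∀ β : ℝ, 15 / 16 ≤ β → β < 1 →
    (riemannZeta β * (DirichletCharacter.LFunction χ₁ β * DirichletCharacter.LFunction χ₂ β *
      DirichletCharacter.LFunction χ₃ β)).re ≤ 0 →
    (1 - β) / 16 ≤
      ‖DirichletCharacter.LFunction χ₁ 1 * DirichletCharacter.LFunction χ₂ 1 *
      DirichletCharacter.LFunction χ₃ 1‖ * (K₁ * (a * b * c)) ^ (5 * (1 - β)) := by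
  obtain ⟨K₀, hK₀, H⟩ := siegel_core
  refine ⟨10 * K₀ + 1, by linarith, ?_⟩
  intro a b c _ _ _ χ₁ χ₂ χ₃ n1 n2 n3 q1 q2 h3 β hβ hβ1 hF
  have ha : (1 : ℝ) ≤ a := by exact_mod_cast Nat.one_le_iff_ne_zero.2 (NeZero.ne a)
  have hb : (1 : ℝ) ≤ b := by exact_mod_cast Nat.one_le_iff_ne_zero.2 (NeZero.ne b)
  have hc : (1 : ℝ) ≤ c := by exact_mod_cast Nat.one_le_iff_ne_zero.2 (NeZero.ne c)
  have habc : (1 : ℝ) ≤ a * b * c := one_le_mul_of_one_le_of_one_le (one_le_mul_of_one_le_of_one_le ha hb) hc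
  set P : ℝ := a * b * c with hP
  set X : ℝ := (10 * K₀ + 1) * P with hX
  have hX1 : 1 ≤ X := one_le_mul_of_one_le_of_one_le (by linarith) habc
  have hX0 : 0 < X := by linarith
  set M : ℕ := ⌈5 * Real.log X⌉₊ + 1 with hM
  have hlog : 0 ≤ Real.log X := Real.log_nonneg hX1
  have hM1 : 5 * Real.log X ≤ M := by
    rw [hM]; push_cast; linarith [Nat.le_ceil (5 * Real.log X)]
  have hM2 : (M : ℝ) ≤ 5 * Real.log X + 2 := by
    rw [hM]; push_cast; linarith [Nat.ceil_lt_add_one (by positivity : 0 ≤ 5 * Real.log X)]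
  have key := H a b c χ₁ χ₂ χ₃ n1 n2 n3 q1 q2 h3 β hβ hβ1 hF M (by omega)
  have h1 : (51 / 64 : ℝ) ^ M ≤ X⁻¹ := by
    have he : (51 / 64 : ℝ) ≤ Real.exp (-(1 / 5)) := by
      linarith [Real.add_one_le_exp (-(1 / 5 : ℝ))]
    calc (51 / 64 : ℝ) ^ M ≤ Real.exp (-(1 / 5)) ^ M := by gcongr
      _ = Real.exp (-(M / 5)) := by rw [← Real.exp_nat_mul]; ring_nf
      _ ≤ Real.exp (-Real.log X) := by apply Real.exp_le_exp.2; linarith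
      _ = X⁻¹ := by rw [Real.exp_neg, Real.exp_log hX0]
  have h2 : 5 * (K₀ * P) * (51 / 64 : ℝ) ^ M ≤ 1 / 2 := by
    calc 5 * (K₀ * P) * (51 / 64 : ℝ) ^ M ≤ 5 * (K₀ * P) * X⁻¹ := by gcongr
      _ ≤ 1 / 2 := by
        rw [← div_eq_mul_inv, div_le_iff₀ hX0, hX]; nlinarith
  have h3 : (2 - β) ^ M ≤ 8 * X ^ (5 * (1 - β)) := by
    have he : 2 - β ≤ Real.exp (1 - β) := by linarith [Real.add_one_le_exp (1 - β)]
    calc (2 - β) ^ M ≤ Real.exp (1 - β) ^ M := pow_le_pow_left₀ (by linarith) he _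
      _ = Real.exp (M * (1 - β)) := by rw [← Real.exp_nat_mul]
      _ ≤ Real.exp (2 + Real.log X * (5 * (1 - β))) := by
        apply Real.exp_le_exp.2; nlinarith
      _ = Real.exp 1 * Real.exp 1 * X ^ (5 * (1 - β)) := by
        rw [Real.rpow_def_of_pos hX0, ← Real.exp_add, ← Real.exp_add]; congr 1; ring
      _ ≤ _ := by
        have : Real.exp 1 * Real.exp 1 ≤ 8 := by nlinarith [Real.exp_one_lt_d9, Real.exp_pos 1]
        gcongr
  set Lm := ‖DirichletCharacter.LFunction χ₁ 1 * DirichletCharacter.LFunction χ₂ 1 *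
      DirichletCharacter.LFunction χ₃ 1‖ with hL
  have hL0 : 0 ≤ Lm := norm_nonneg _
  have h4 : (1 - β) * (1 / 2) ≤ Lm * (8 * X ^ (5 * (1 - β))) := by
    calc _ ≤ (1 - β) * (1 - 5 * (K₀ * P) * (51 / 64 : ℝ) ^ M) := by
          apply mul_le_mul_of_nonneg_left _ (by linarith); linarith
      _ ≤ _ := key
      _ ≤ _ := by gcongr
  linarith

lemma quad_real {q : ℕ} [NeZero q] {χ : DirichletCharacter ℂ q} (hχ : χ ≠ 1) (h2 : χ ^ 2 = 1)
    {x : ℝ} (hx : 0 < x) : (DirichletCharacter.LFunction χ x).im = 0 := by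
  have h := SN_tendsto χ hχ (x : ℂ) (by simpa using hx)
  have h' := (Complex.continuous_im.tendsto _).comp h
  refine tendsto_nhds_unique h' ?_
  refine tendsto_const_nhds.congr fun N => ?_
  simp only [Function.comp, SN, Complex.im_sum]
  symm
  refine sum_eq_zero fun n hn => ?_
  have : ((n : ℂ)) ^ (-(x : ℂ)) = (((n : ℝ) ^ (-x) : ℝ) : ℂ) := by
    rw [Complex.ofReal_cpow (by positivity)]; push_cast; rfl
  rw [this]
  rcases quad_val h2 n with h | h | h <;> rw [h] <;> simp

lemma quad_two_nonneg {q : ℕ} [NeZero q] {χ : DirichletCharacter ℂ q} (hχ : χ ≠ 1) (h2 : χ ^ 2 = 1) :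
    0 ≤ (DirichletCharacter.LFunction χ (2 : ℝ)).re := by
  have h := SN_tendsto χ hχ ((2 : ℝ) : ℂ) (by simp)
  have h' := (Complex.continuous_re.tendsto _).comp h
  have key : ∀ N : ℕ, (1 : ℝ) / (N + 1) ≤ (SN χ (N + 1) ((2 : ℝ) : ℂ)).re := by
    intro N
    induction N with
    | zero => simp [SN]
    | succ N ih =>
      have hs : SN χ (N + 1 + 1) ((2 : ℝ) : ℂ) = SN χ (N + 1) ((2 : ℝ) : ℂ) +
          χ ((N + 1 + 1 : ℕ) : ZMod q) * ((N + 1 + 1 : ℕ) : ℂ) ^ (-((2 : ℝ) : ℂ)) := by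
        simp only [SN]
        rw [← Finset.insert_Ioc_right_eq_Ioc_add_one (by omega : 0 ≤ N + 1), sum_insert (by simp), add_comm]
      have hv : ((N + 1 + 1 : ℕ) : ℂ) ^ (-((2 : ℝ) : ℂ)) = (((1 : ℝ) / (N + 2) ^ 2 : ℝ) : ℂ) := by
        rw [Complex.cpow_neg]
        simp only [Complex.ofReal_ofNat, Complex.cpow_ofNat]
        push_cast; rw [one_div]; ring
      have hv2 : -((1 : ℝ) / (N + 2) ^ 2) ≤
          (χ ((N + 1 + 1 : ℕ) : ZMod q) * ((N + 1 + 1 : ℕ) : ℂ) ^ (-((2 : ℝ) : ℂ))).re := by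
        rw [hv, Complex.re_mul_ofReal]
        have hp : (0 : ℝ) < 1 / (N + 2) ^ 2 := by positivity
        rcases quad_val h2 (N + 1 + 1) with h | h | h <;> rw [h] <;> simp only [Complex.zero_re, Complex.one_re, Complex.neg_re] <;> linarith
      rw [hs, Complex.add_re]
      have : (1 : ℝ) / ((N + 1 : ℕ) + 1) ≤ 1 / (N + 1) - 1 / (N + 2) ^ 2 := by
        push_cast
        rw [div_sub_div _ _ (by positivity) (by positivity), div_le_div_iff₀ (by positivity) (by positivity)]
        ring_nf
        have : (0 : ℝ) ≤ N := by positivity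
        nlinarith
      linarith
  refine ge_of_tendsto h' ?_
  filter_upwards [eventually_ge_atTop 1] with N hN
  obtain ⟨M, rfl⟩ : ∃ M, N = M + 1 := ⟨N - 1, by omega⟩
  exact le_trans (by positivity) (key M)

lemma quad_pos {q : ℕ} [NeZero q] {χ : DirichletCharacter ℂ q} (hχ : χ ≠ 1) (h2 : χ ^ 2 = 1)
    {β : ℝ} (hβ : 0 < β) (hβ1 : β < 1)
    (hz : ∀ x : ℝ, β ≤ x → x < 1 → DirichletCharacter.LFunction χ x ≠ 0) :
    ∃ r : ℝ, 0 < r ∧ DirichletCharacter.LFunction χ β = r := by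
  set f : ℝ → ℝ := fun x => (DirichletCharacter.LFunction χ x).re with hf
  have hval : ∀ x : ℝ, 0 < x → DirichletCharacter.LFunction χ x = f x := by
    intro x hx
    apply Complex.ext
    · simp [hf]
    · simp [quad_real hχ h2 hx]
  have hne : ∀ x : ℝ, β ≤ x → f x ≠ 0 := by
    intro x hx h0
    have h1 := hval x (by linarith)
    rw [h0, Complex.ofReal_zero] at h1
    rcases lt_or_ge x 1 with h | h
    · exact hz x hx h h1
    · exact DirichletCharacter.LFunction_ne_zero_of_one_le_re χ (.inl hχ) (by simpa using h) h1
  have hcont : Continuous f :=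
    Complex.continuous_re.comp ((DirichletCharacter.differentiable_LFunction hχ).continuous.comp
      Complex.continuous_ofReal)
  have hf2 : 0 < f 2 := lt_of_le_of_ne (quad_two_nonneg hχ h2) (hne 2 (by linarith)).symm
  refine ⟨f β, ?_, hval β hβ⟩
  by_contra hneg
  push Not at hneg
  obtain ⟨x, hx, hx0⟩ := intermediate_value_Icc (by linarith : β ≤ 2) hcont.continuousOn
    (show (0 : ℝ) ∈ Set.Icc (f β) (f 2) from ⟨hneg, hf2.le⟩)
  exact hne x hx.1 hx0

lemma chi4_ex : ∃ χ : DirichletCharacter ℂ 4, χ ≠ 1 ∧ χ ^ 2 = 1 := by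
  refine ⟨ZMod.χ₄.ringHomComp (Int.castRingHom ℂ), ?_, ?_⟩
  · intro h
    have := congrArg (fun c : DirichletCharacter ℂ 4 => c (3 : ZMod 4)) h
    have h3 : ZMod.χ₄ (3 : ZMod 4) = -1 := by decide
    have hu : IsUnit (3 : ZMod 4) := by decide
    simp only [MulChar.ringHomComp_apply, h3, MulChar.one_apply hu] at this
    norm_num at this
  · exact MulChar.isQuadratic_iff_sq_eq_one.mp (ZMod.isQuadratic_χ₄.comp _)

lemma zeta_neg : ∃ δ₀ : ℝ, 0 < δ₀ ∧ ∀ δ : ℝ, 0 < δ → δ ≤ δ₀ → (riemannZeta ((1 - δ : ℝ) : ℂ)).re ≤ 0 := by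
  obtain ⟨Z, hZ⟩ := (isCompact_closedBall (1 : ℂ) 1).exists_bound_of_continuousOn
    differentiable_riemannZeta₀.continuous.continuousOn
  have hZ0 : 0 ≤ Z := (norm_nonneg _).trans (hZ 1 (by simp))
  refine ⟨1 / (Z + 1), by positivity, fun δ hδ hδ2 => ?_⟩
  have hδ1 : δ ≤ 1 := hδ2.trans (by rw [div_le_one (by positivity)]; linarith)
  have hne : ((1 - δ : ℝ) : ℂ) ≠ 1 := by
    intro h; have : (1 - δ : ℝ) = 1 := by exact_mod_cast h
    linarith
  rw [riemannZeta_eq_inv_sub_add hne, Complex.add_re]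
  have h1 : (((1 - δ : ℝ) : ℂ) - 1)⁻¹ = ((-(δ⁻¹) : ℝ) : ℂ) := by
    push_cast; rw [← inv_neg]; ring_nf
  have h2 := hZ ((1 - δ : ℝ) : ℂ) (by
    rw [mem_closedBall_iff_norm]; push_cast
    rw [show (1 : ℂ) - δ - 1 = -((δ : ℝ) : ℂ) by ring, norm_neg, Complex.norm_real, Real.norm_eq_abs, abs_of_pos hδ]
    exact hδ1)
  have h3 := (Complex.re_le_norm (riemannZeta₀ ((1 - δ : ℝ) : ℂ))).trans h2
  rw [h1, Complex.ofReal_re]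
  have h4 : Z + 1 ≤ δ⁻¹ := by
    rw [le_inv_comm₀ (by positivity) hδ, ← one_div]; exact hδ2
  linarith

lemma exists_base : ∃ δ₀ : ℝ, 0 < δ₀ ∧ ∀ δ : ℝ, 0 < δ → δ ≤ δ₀ → δ ≤ 1 / 16 →
    ∃ (a : ℕ) (_ : NeZero a) (χ₁ : DirichletCharacter ℂ a) (β : ℝ), χ₁ ≠ 1 ∧ χ₁ ^ 2 = 1 ∧ 1 - δ ≤ β ∧
      β < 1 ∧ ∀ (b c : ℕ) [NeZero b] [NeZero c] (χ₂ : DirichletCharacter ℂ b)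
        (χ₃ : DirichletCharacter ℂ c), χ₂ ≠ 1 → χ₃ ≠ 1 → χ₂ ^ 2 = 1 → χ₃ ^ 2 = 1 →
        (riemannZeta β * (DirichletCharacter.LFunction χ₁ β * DirichletCharacter.LFunction χ₂ β *
          DirichletCharacter.LFunction χ₃ β)).re ≤ 0 := by
  obtain ⟨δ₀, hδ₀, H⟩ := zeta_neg
  refine ⟨δ₀, hδ₀, fun δ hδ hδ1 hδ2 => ?_⟩
  by_cases hB : ∃ (a : ℕ) (_ : NeZero a) (χ₁ : DirichletCharacter ℂ a) (β : ℝ), χ₁ ≠ 1 ∧ χ₁ ^ 2 = 1 ∧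
      1 - δ ≤ β ∧ β < 1 ∧ DirichletCharacter.LFunction χ₁ β = 0
  · obtain ⟨a, ha, χ₁, β, h1, h2, h3, h4, h5⟩ := hB
    refine ⟨a, ha, χ₁, β, h1, h2, h3, h4, ?_⟩
    intros
    rw [h5]; simp
  · push Not at hB
    obtain ⟨χ, hχ, hχ2⟩ := chi4_ex
    refine ⟨4, inferInstance, χ, 1 - δ, hχ, hχ2, le_refl _, by linarith, ?_⟩
    intro b c _ _ χ₂ χ₃ n2 n3 q2 q3
    obtain ⟨r1, p1, e1⟩ := quad_pos hχ hχ2 (β := 1 - δ) (by linarith) (by linarith)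
      (fun x hx hx1 => hB _ inferInstance _ _ hχ hχ2 hx hx1)
    obtain ⟨r2, p2, e2⟩ := quad_pos n2 q2 (β := 1 - δ) (by linarith) (by linarith)
      (fun x hx hx1 => hB _ inferInstance _ _ n2 q2 hx hx1)
    obtain ⟨r3, p3, e3⟩ := quad_pos n3 q3 (β := 1 - δ) (by linarith) (by linarith)
      (fun x hx hx1 => hB _ inferInstance _ _ n3 q3 hx hx1)
    rw [e1, e2, e3, ← Complex.ofReal_mul, ← Complex.ofReal_mul, Complex.re_mul_ofReal]
    exact mul_nonpos_of_nonpos_of_nonneg (H δ hδ hδ1) (by positivity)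

end MomentProof

namespace MomentProof
open Finset Filter Topology

lemma lower_small (A : ℕ) : ∃ c : ℝ, 0 < c ∧ ∀ (q : ℕ) [NeZero q], q ≤ A →
    ∀ χ : DirichletCharacter ℂ q, χ ≠ 1 → c ≤ ‖DirichletCharacter.LFunction χ 1‖ := by
  have hone : ∀ q : ℕ, ∃ c : ℝ, 0 < c ∧ ∀ [NeZero q] (χ : DirichletCharacter ℂ q), χ ≠ 1 →
      c ≤ ‖DirichletCharacter.LFunction χ 1‖ := by
    intro q
    rcases eq_or_ne q 0 with h | h
    · exact ⟨1, one_pos, fun {hq} => absurd h hq.out⟩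
    have : NeZero q := ⟨h⟩
    obtain ⟨χ₀, hχ₀⟩ := Finite.exists_min (fun χ : DirichletCharacter ℂ q =>
      if χ = 1 then (1 : ℝ) else ‖DirichletCharacter.LFunction χ 1‖)
    refine ⟨if χ₀ = 1 then (1 : ℝ) else ‖DirichletCharacter.LFunction χ₀ 1‖, ?_, ?_⟩
    · split_ifs with h1
      · exact one_pos
      · exact norm_pos_iff.2 (DirichletCharacter.LFunction_apply_one_ne_zero h1)
    · intro _ χ hχ
      have := hχ₀ χ
      rwa [if_neg hχ] at this
  induction A with
  | zero =>
    exact ⟨1, one_pos, fun q hq h => absurd (Nat.le_zero.1 h) hq.out⟩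
  | succ A ih =>
    obtain ⟨c, hc, H⟩ := ih
    obtain ⟨c', hc', H'⟩ := hone (A + 1)
    refine ⟨min c c', lt_min hc hc', fun q _ hq χ hχ => ?_⟩
    rcases Nat.lt_or_ge q (A + 1) with h | h
    · exact (min_le_left _ _).trans (H q (by omega) χ hχ)
    · obtain rfl : q = A + 1 := le_antisymm hq h
      exact (min_le_right _ _).trans (H' χ hχ)

lemma char_prod {a b : ℕ} [NeZero a] [NeZero b] (hab : a.Coprime b) (χ₁ : DirichletCharacter ℂ a)
    (χ₂ : DirichletCharacter ℂ b) (h1 : χ₁ ^ 2 = 1) (h2 : χ₂ ^ 2 = 1) (hn2 : χ₂ ≠ 1) :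
    ∃ χ₃ : DirichletCharacter ℂ (a * b), χ₃ ≠ 1 ∧ χ₃ ^ 2 = 1 ∧ ∀ n : ℕ, χ₃ n = χ₁ n * χ₂ n := by
  have hda : a ∣ a * b := Dvd.intro _ rfl
  have hdb : b ∣ a * b := Dvd.intro_left _ rfl
  set χ₃ := DirichletCharacter.changeLevel hda χ₁ * DirichletCharacter.changeLevel hdb χ₂ with h3
  have hval : ∀ n : ℕ, χ₃ n = χ₁ n * χ₂ n := by
    intro n
    by_cases hu : IsUnit ((n : ℕ) : ZMod (a * b))
    · rw [h3, MulChar.mul_apply]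
      have e1 := DirichletCharacter.changeLevel_eq_cast_of_dvd χ₁ hda hu.unit
      have e2 := DirichletCharacter.changeLevel_eq_cast_of_dvd χ₂ hdb hu.unit
      simp only [IsUnit.unit_spec] at e1 e2
      rw [e1, e2, ZMod.cast_natCast hda, ZMod.cast_natCast hdb]
    · rw [MulChar.map_nonunit _ hu]
      by_cases hua : IsUnit ((n : ℕ) : ZMod a)
      · have hub : ¬ IsUnit ((n : ℕ) : ZMod b) := by
          intro hub
          rw [ZMod.isUnit_iff_coprime] at *
          exact hu (Nat.Coprime.mul_right hua hub)
        rw [MulChar.map_nonunit _ hub, mul_zero]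
      · rw [MulChar.map_nonunit _ hua, zero_mul]
  refine ⟨χ₃, ?_, ?_, hval⟩
  · intro h
    apply hn2
    ext u
    obtain ⟨n, hna, hnb⟩ := Nat.chineseRemainder hab 1 (u : ZMod b).val
    have ea : ((n : ℕ) : ZMod a) = 1 := by
      have := (ZMod.natCast_eq_natCast_iff _ _ _).2 hna; simpa using this
    have eb : ((n : ℕ) : ZMod b) = u := by
      have := (ZMod.natCast_eq_natCast_iff _ _ _).2 hnb; simpa using this
    have hv := hval n
    rw [ea, eb, map_one, one_mul, h] at hv
    rw [← hv]
    have hu : IsUnit ((n : ℕ) : ZMod (a * b)) := by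
      rw [ZMod.isUnit_iff_coprime]
      refine Nat.Coprime.mul_right ?_ ?_
      · rw [← ZMod.isUnit_iff_coprime, ea]; exact isUnit_one
      · rw [← ZMod.isUnit_iff_coprime, eb]; exact u.isUnit
    rw [MulChar.one_apply hu, MulChar.one_apply u.isUnit]
  · rw [h3, mul_pow, ← map_pow, ← map_pow, h1, h2, map_one, map_one, one_mul]

lemma lower_quad (η : ℝ) (hη : 0 < η) :
    ∃ c : ℝ, 0 < c ∧ ∀ (q : ℕ) [NeZero q], q.Prime → ∀ (χ : DirichletCharacter ℂ q), χ ≠ 1 → χ ^ 2 = 1 →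
      c * (q : ℝ) ^ (-η) ≤ ‖DirichletCharacter.LFunction χ 1‖ := by
  obtain ⟨δ₀, hδ₀, H⟩ := exists_base
  obtain ⟨K₁, hK₁, HK⟩ := siegel_core2
  set δ : ℝ := min (min δ₀ (1 / 16)) (η / 13) with hδ
  have hδ0 : 0 < δ := by rw [hδ]; positivity
  have d1 : δ ≤ δ₀ := (min_le_left _ _).trans (min_le_left _ _)
  have d2 : δ ≤ 1 / 16 := (min_le_left _ _).trans (min_le_right _ _)
  have d3 : δ ≤ η / 13 := min_le_right _ _
  obtain ⟨a, ha, χ₁, β, n1, q1, hβ, hβ1, Hb⟩ := H δ hδ0 d1 d2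
  obtain ⟨c₀, hc₀, H₀⟩ := lower_small a
  obtain ⟨C, hC, HC⟩ := L_bound δ hδ0 (by linarith)
  have ha1 : (1 : ℝ) ≤ a := by exact_mod_cast Nat.one_le_iff_ne_zero.2 (NeZero.ne a)
  have hL1 : 0 < ‖DirichletCharacter.LFunction χ₁ 1‖ :=
    norm_pos_iff.2 (DirichletCharacter.LFunction_apply_one_ne_zero n1)
  set L1 := ‖DirichletCharacter.LFunction χ₁ 1‖
  set D : ℝ := L1 * (C * (a : ℝ) ^ (3 * δ)) * (K₁ * (a * a)) ^ (5 * δ) with hD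
  have hD0 : 0 < D := by positivity
  refine ⟨min c₀ ((1 - β) / 16 / D), lt_min hc₀ (by have : 0 < 1 - β := by linarith
                                                    positivity), ?_⟩
  intro q _ hq χ hχ hχ2
  have hq1 : (1 : ℝ) ≤ q := by exact_mod_cast hq.one_lt.le
  rcases Nat.lt_or_ge a q with haq | haq
  · have hcop : a.Coprime q := by
      refine Nat.Coprime.symm ((Nat.Prime.coprime_iff_not_dvd hq).2 fun h => ?_)
      exact absurd (Nat.le_of_dvd (Nat.pos_of_ne_zero (NeZero.ne a)) h) (by omega)
    obtain ⟨χ₃, n3, q3, h3⟩ := char_prod hcop χ₁ χ q1 hχ2 hχ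
    have key := HK a q (a * q) χ₁ χ χ₃ n1 hχ n3 q1 hχ2 h3 β (by linarith) hβ1
      (Hb q (a * q) χ χ₃ hχ n3 hχ2 q3)
    have hL3 := HC (a * q) χ₃ n3 1 (by simpa using hδ0.le)
    rw [norm_mul, norm_mul] at key
    set L2 := ‖DirichletCharacter.LFunction χ 1‖
    have hL20 : 0 ≤ L2 := norm_nonneg _
    have hb1 : 1 ≤ K₁ * ((a : ℝ) * q * (a * q : ℕ)) := by
      push_cast
      exact one_le_mul_of_one_le_of_one_le hK₁ (one_le_mul_of_one_le_of_one_le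
        (one_le_mul_of_one_le_of_one_le ha1 hq1) (one_le_mul_of_one_le_of_one_le ha1 hq1))
    have h5 : (K₁ * ((a : ℝ) * q * (a * q : ℕ))) ^ (5 * (1 - β)) ≤
        (K₁ * (a * a)) ^ (5 * δ) * (q : ℝ) ^ (10 * δ) := by
      calc _ ≤ (K₁ * ((a : ℝ) * q * (a * q : ℕ))) ^ (5 * δ) :=
            Real.rpow_le_rpow_of_exponent_le hb1 (by linarith)
        _ = ((K₁ * (a * a)) * ((q : ℝ) ^ (2 : ℝ))) ^ (5 * δ) := by
            congr 1; rw [Real.rpow_two]; push_cast; ring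
        _ = _ := by
            rw [Real.mul_rpow (by positivity) (by positivity), ← Real.rpow_mul (by positivity)]
            ring_nf
    have h6 : (1 - β) / 16 ≤ L2 * (D * (q : ℝ) ^ (13 * δ)) := by
      calc _ ≤ _ := key
        _ ≤ L1 * L2 * (C * ((a * q : ℕ) : ℝ) ^ (3 * δ)) * ((K₁ * (a * a)) ^ (5 * δ) * (q : ℝ) ^ (10 * δ)) := by
            gcongr
        _ = L2 * (D * ((q : ℝ) ^ (3 * δ) * (q : ℝ) ^ (10 * δ))) := by
            push_cast; rw [Real.mul_rpow (by positivity) (by positivity), hD]; ring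
        _ = _ := by rw [← Real.rpow_add (by linarith)]; ring_nf
    have h7 : (q : ℝ) ^ (13 * δ) ≤ (q : ℝ) ^ η := Real.rpow_le_rpow_of_exponent_le hq1 (by linarith)
    have h8 : (1 - β) / 16 / D ≤ L2 * (q : ℝ) ^ η := by
      rw [div_le_iff₀ hD0]
      calc _ ≤ _ := h6
        _ ≤ L2 * (D * (q : ℝ) ^ η) := by gcongr
        _ = _ := by ring
    have hp : 0 < (q : ℝ) ^ η := by positivity
    rw [Real.rpow_neg (by linarith), ← div_eq_mul_inv, div_le_iff₀ hp]
    exact (min_le_right _ _).trans h8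
  · have h9 := H₀ q haq χ hχ
    calc _ ≤ c₀ * 1 := by
          gcongr
          · exact min_le_left _ _
          · exact Real.rpow_le_one_of_one_le_of_nonpos hq1 (by linarith)
      _ ≤ _ := by linarith

/-- Uniform bound for the logarithmic derivative at `1`. -/
lemma logDeriv_bound (η : ℝ) (hη : 0 < η) :
    ∃ C : ℝ, 0 < C ∧ ∀ (q : ℕ) [NeZero q], q.Prime → ∀ (χ : DirichletCharacter ℂ q), χ ≠ 1 →
      ‖logDeriv (DirichletCharacter.LFunction χ) 1‖ ≤ C * (q : ℝ) ^ η := by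
  set θ : ℝ := min (1 / 2) (η / 15) with hθ
  have hθ0 : 0 < θ := by rw [hθ]; positivity
  have t1 : θ ≤ 1 / 2 := min_le_left _ _
  have t2 : θ ≤ η / 15 := min_le_right _ _
  obtain ⟨c1, hc1, H1⟩ := lower_complex θ hθ0 t1
  obtain ⟨c2, hc2, H2⟩ := lower_quad (12 * θ) (by positivity)
  obtain ⟨C, hC, H3⟩ := L_deriv_bound θ hθ0 t1
  have hm : 0 < min c1 c2 := lt_min hc1 hc2
  refine ⟨C / min c1 c2, by positivity, fun q _ hq χ hχ => ?_⟩
  have hq1 : (1 : ℝ) ≤ q := by exact_mod_cast hq.one_lt.le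
  have hlow : min c1 c2 * (q : ℝ) ^ (-(12 * θ)) ≤ ‖DirichletCharacter.LFunction χ 1‖ := by
    by_cases h : χ ^ 2 = 1
    · refine le_trans ?_ (H2 q hq χ hχ h); gcongr; exact min_le_right _ _
    · refine le_trans ?_ (H1 q hq χ h); gcongr; exact min_le_left _ _
  have hup := (H3 q χ hχ 1 (by simpa using by positivity)).2
  rw [logDeriv_apply, norm_div]
  have hp : 0 < min c1 c2 * (q : ℝ) ^ (-(12 * θ)) := by positivity
  calc _ ≤ (C * (q : ℝ) ^ (3 * θ)) / (min c1 c2 * (q : ℝ) ^ (-(12 * θ))) := by gcongr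
    _ = C / min c1 c2 * (q : ℝ) ^ (15 * θ) := by
      rw [mul_div_mul_comm, ← Real.rpow_sub (by linarith)]; ring_nf
    _ ≤ _ := by
      gcongr
      linarith

end MomentProof

namespace MomentProof
open Finset Filter Topology

lemma divisor_bound (η : ℝ) (hη : 0 < η) :
    ∃ C : ℝ, 0 < C ∧ ∀ n : ℕ, n ≠ 0 → (n.divisors.card : ℝ) ≤ C * (n : ℝ) ^ η := by
  have hl2 : 0 < Real.log 2 := Real.log_pos one_lt_two
  set K : ℝ := 1 + 1 / (η * Real.log 2) with hK
  have hK1 : 1 ≤ K := by rw [hK]; have : 0 < 1 / (η * Real.log 2) := by positivity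
                         linarith
  set P : ℕ := ⌈(2 : ℝ) ^ (1 / η)⌉₊ with hP
  have hloc : ∀ p : ℕ, p.Prime → ∀ a : ℕ, ((a + 1 : ℕ) : ℝ) ≤ (if p < P then K else 1) * (((p ^ a : ℕ) : ℝ)) ^ η := by
    intro p hp a
    have hp2 : (2 : ℝ) ≤ p := by exact_mod_cast hp.two_le
    have hpa : (((p ^ a : ℕ) : ℝ)) ^ η = (((p : ℝ)) ^ η) ^ a := by
      push_cast
      rw [← Real.rpow_natCast, ← Real.rpow_mul (by positivity), mul_comm, Real.rpow_mul (by positivity), Real.rpow_natCast]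
    rw [hpa]
    split_ifs with h
    · have h1 : 1 + η * Real.log 2 * a ≤ ((p : ℝ) ^ η) ^ a := by
        calc 1 + η * Real.log 2 * a ≤ Real.exp (η * Real.log 2 * a) := by
              linarith [Real.add_one_le_exp (η * Real.log 2 * a)]
          _ = ((2 : ℝ) ^ η) ^ a := by
              rw [Real.rpow_def_of_pos two_pos, ← Real.exp_nat_mul]; ring_nf
          _ ≤ _ := by gcongr
      have h2 : ((a + 1 : ℕ) : ℝ) ≤ K * (1 + η * Real.log 2 * a) := by
        rw [hK]; push_cast
        have h3 : (1 + 1 / (η * Real.log 2)) * (1 + η * Real.log 2 * a) =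
            1 + a + (η * Real.log 2 * a + 1 / (η * Real.log 2)) := by field_simp; ring
        rw [h3]
        have : 0 ≤ η * Real.log 2 * a + 1 / (η * Real.log 2) := by positivity
        linarith
      exact h2.trans (by gcongr)
    · have h1 : (2 : ℝ) ≤ (p : ℝ) ^ η := by
        have h2 : (2 : ℝ) ^ (1 / η) ≤ p := (Nat.le_ceil _).trans (by exact_mod_cast not_lt.1 h)
        calc (2 : ℝ) = ((2 : ℝ) ^ (1 / η)) ^ η := by
              rw [← Real.rpow_mul (by norm_num), one_div_mul_cancel hη.ne', Real.rpow_one]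
          _ ≤ _ := by gcongr
      rw [one_mul]
      calc ((a + 1 : ℕ) : ℝ) ≤ (2 : ℝ) ^ a := by exact_mod_cast Nat.lt_two_pow_self
        _ ≤ _ := by gcongr
  refine ⟨K ^ P, by positivity, fun n hn => ?_⟩
  rw [Nat.card_divisors hn]
  push_cast
  have hn' : (n : ℝ) ^ η = ∏ p ∈ n.primeFactors, (((p ^ n.factorization p : ℕ) : ℝ)) ^ η := by
    rw [Real.finsetProd_rpow _ _ (fun _ _ => by positivity)]
    congr 1
    conv_lhs => rw [← Nat.prod_factorization_pow_eq_self hn]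
    rw [Finsupp.prod, Nat.support_factorization]; push_cast; rfl
  calc ∏ p ∈ n.primeFactors, ((n.factorization p : ℝ) + 1)
      ≤ ∏ p ∈ n.primeFactors, ((if p < P then K else 1) * (((p ^ n.factorization p : ℕ) : ℝ)) ^ η) := by
        refine prod_le_prod (fun _ _ => by positivity) fun p hp => ?_
        have := hloc p (Nat.prime_of_mem_primeFactors hp) (n.factorization p)
        exact_mod_cast this
    _ = (∏ p ∈ n.primeFactors, (if p < P then K else 1)) * (n : ℝ) ^ η := by
        rw [prod_mul_distrib, hn']
    _ ≤ K ^ P * (n : ℝ) ^ η := by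
        gcongr
        rw [prod_ite, prod_const, prod_const_one, mul_one]
        refine pow_le_pow_right₀ hK1 ?_
        calc _ ≤ (range P).card := card_le_card fun p hp => by
              simpa using (mem_filter.1 hp).2
          _ = P := card_range P

/-- Truncation. -/
noncomputable def trunc (N : ℕ) (f : ArithmeticFunction ℂ) : ArithmeticFunction ℂ :=
  ⟨fun n => if n ≤ N then f n else 0, by simp⟩

lemma trunc_apply (N : ℕ) (f : ArithmeticFunction ℂ) (n : ℕ) :
    trunc N f n = if n ≤ N then f n else 0 := rfl

/-- Twisted Dirichlet polynomial at `1`. -/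
noncomputable def Tw {q : ℕ} (χ : DirichletCharacter ℂ q) (Z : ℕ) (f : ArithmeticFunction ℂ) : ℂ :=
  ∑ n ∈ Ioc 0 Z, f n * (χ (n : ZMod q) / n)

lemma Tw_trunc {q : ℕ} (χ : DirichletCharacter ℂ q) (Z : ℕ) (f : ArithmeticFunction ℂ) :
    Tw χ Z (trunc Z f) = Tw χ Z f := by
  unfold Tw
  refine sum_congr rfl fun n hn => ?_
  rw [trunc_apply, if_pos (mem_Ioc.1 hn).2]

lemma Tw_add {q : ℕ} (χ : DirichletCharacter ℂ q) (Z : ℕ) (f g : ArithmeticFunction ℂ) :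
    Tw χ Z (f + g) = Tw χ Z f + Tw χ Z g := by
  unfold Tw
  rw [← sum_add_distrib]
  refine sum_congr rfl fun n hn => ?_
  rw [ArithmeticFunction.add_apply]; ring

lemma Tw_mono {q : ℕ} (χ : DirichletCharacter ℂ q) {Z Z' : ℕ} (h : Z ≤ Z') (f : ArithmeticFunction ℂ)
    (hf : ∀ n, Z < n → f n = 0) : Tw χ Z f = Tw χ Z' f := by
  unfold Tw
  refine sum_subset (Ioc_subset_Ioc_right h) fun n hn hn' => ?_
  rw [hf n, zero_mul]
  simp only [mem_Ioc] at hn hn'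
  omega

lemma Tw_mul {q : ℕ} (χ : DirichletCharacter ℂ q) (N M : ℕ) (f g : ArithmeticFunction ℂ)
    (hf : ∀ n, N < n → f n = 0) (hg : ∀ n, M < n → g n = 0) :
    Tw χ N f * Tw χ M g = Tw χ (N * M) (f * g) := by
  unfold Tw
  rw [sum_mul_sum, ← sum_product']
  rw [← sum_fiberwise_of_maps_to (s := Ioc 0 N ×ˢ Ioc 0 M) (t := Ioc 0 (N * M))
    (g := fun p => p.1 * p.2)]
  · refine sum_congr rfl fun n hn => ?_
    rw [ArithmeticFunction.mul_apply, sum_mul]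
    have hn0 : n ≠ 0 := (mem_Ioc.1 hn).1.ne'
    have hsub : ((Ioc 0 N ×ˢ Ioc 0 M).filter fun p => p.1 * p.2 = n) ⊆ n.divisorsAntidiagonal := by
      intro p hp
      exact Nat.mem_divisorsAntidiagonal.2 ⟨(mem_filter.1 hp).2, hn0⟩
    refine (sum_congr rfl fun p hp => ?_).trans (sum_subset hsub fun p hp hp' => ?_)
    · have := (mem_filter.1 hp).2
      rw [← this]; push_cast; rw [map_mul]; ring
    · obtain ⟨h1, _⟩ := Nat.mem_divisorsAntidiagonal.1 hp
      have hp1 : p.1 ≠ 0 := by rintro h; simp [h] at h1; exact hn0 h1.symm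
      have hp2 : p.2 ≠ 0 := by rintro h; simp [h] at h1; exact hn0 h1.symm
      by_cases h3 : N < p.1
      · rw [hf _ h3]; ring
      by_cases h4 : M < p.2
      · rw [hg _ h4]; ring
      · exfalso; apply hp'
        simp only [mem_filter, mem_product, mem_Ioc]
        omega
  · intro p hp
    simp only [mem_product, mem_Ioc] at hp ⊢
    exact ⟨Nat.mul_pos hp.1.1 hp.2.1, Nat.mul_le_mul hp.1.2 hp.2.2⟩

lemma orth {q : ℕ} [NeZero q] (m n : ℕ) :
    ∑ χ : DirichletCharacter ℂ q, χ (m : ZMod q) * star (χ (n : ZMod q)) =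
      if (n : ZMod q) = m ∧ IsUnit (n : ZMod q) then (q.totient : ℂ) else 0 := by
  by_cases hu : IsUnit (n : ZMod q)
  · have := DirichletCharacter.sum_char_inv_mul_char_eq ℂ hu (m : ZMod q)
    simp only [hu, and_true]
    rw [← this]
    refine sum_congr rfl fun χ _ => ?_
    rw [MulChar.star_apply', mul_comm]
    congr 1
    rw [MulChar.inv_apply]
    congr 1
    obtain ⟨u, hu'⟩ := hu
    rw [← hu', Ring.inverse_unit]
    exact (ZMod.inv_coe_unit u).symm
  · simp only [hu, and_false, if_false]
    refine sum_eq_zero fun χ _ => ?_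
    rw [MulChar.map_nonunit _ hu]; simp

lemma offdiag_half (q Z m : ℕ) (hq : 0 < q) :
    ∑ n ∈ Ioc 0 Z with (m < n ∧ (n : ZMod q) = m), (n : ℝ)⁻¹ ≤ (q : ℝ)⁻¹ * (1 + Real.log Z) := by
  have hsub : ((Ioc 0 Z).filter fun n => m < n ∧ (n : ZMod q) = m) ⊆
      (Ioc 0 Z).image (fun j => m + j * q) := by
    intro n hn
    simp only [mem_filter, mem_Ioc, mem_image] at hn ⊢
    obtain ⟨⟨h1, h2⟩, h3, h4⟩ := hn
    have h5 := (ZMod.natCast_eq_natCast_iff _ _ _).1 h4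
    obtain ⟨j, hj⟩ := (Nat.modEq_iff_dvd' h3.le).1 h5.symm
    have hj0 : 0 < j := by
      rcases Nat.eq_zero_or_pos j with h | h
      · subst h; simp at hj; omega
      · exact h
    have hle : j ≤ q * j := Nat.le_mul_of_pos_left j hq
    exact ⟨j, ⟨hj0, by omega⟩, by rw [mul_comm j q]; omega⟩
  calc _ ≤ ∑ n ∈ (Ioc 0 Z).image (fun j => m + j * q), (n : ℝ)⁻¹ :=
        sum_le_sum_of_subset_of_nonneg hsub fun _ _ _ => by positivity
    _ = ∑ j ∈ Ioc 0 Z, ((m + j * q : ℕ) : ℝ)⁻¹ := by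
        rw [sum_image]
        intro i _ j _ h
        simp only [add_right_inj] at h
        exact Nat.eq_of_mul_eq_mul_right hq h
    _ ≤ ∑ j ∈ Ioc 0 Z, (q : ℝ)⁻¹ * (j : ℝ)⁻¹ := by
        refine sum_le_sum fun j hj => ?_
        have hj0 : (0 : ℝ) < j := by exact_mod_cast (mem_Ioc.1 hj).1
        have hq0 : (0 : ℝ) < q := by exact_mod_cast hq
        rw [← mul_inv]
        apply inv_anti₀ (by positivity)
        push_cast
        have : (0 : ℝ) ≤ m := by positivity
        nlinarith
    _ ≤ _ := by
        rw [← mul_sum]; gcongr; exact harm_le Z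

lemma offdiag (q Z : ℕ) (hq : 0 < q) :
    ∑ m ∈ Ioc 0 Z, ∑ n ∈ Ioc 0 Z, (if n ≠ m ∧ (n : ZMod q) = m then ((m : ℝ)⁻¹ * (n : ℝ)⁻¹) else 0)
      ≤ (q : ℝ)⁻¹ * (2 * (1 + Real.log Z) ^ 2) := by
  have hlogZ : 0 ≤ Real.log Z := Real.log_natCast_nonneg Z
  set A : ℝ := ∑ m ∈ Ioc 0 Z, ∑ n ∈ Ioc 0 Z, (if m < n ∧ (n : ZMod q) = m then ((m : ℝ)⁻¹ * (n : ℝ)⁻¹) else 0) with hA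
  have hAle : A ≤ (q : ℝ)⁻¹ * (1 + Real.log Z) ^ 2 := by
    calc A ≤ ∑ m ∈ Ioc 0 Z, (m : ℝ)⁻¹ * ((q : ℝ)⁻¹ * (1 + Real.log Z)) := by
          refine sum_le_sum fun m hm => ?_
          rw [← sum_filter, ← mul_sum]
          gcongr
          exact offdiag_half q Z m hq
      _ = (∑ m ∈ Ioc 0 Z, (m : ℝ)⁻¹) * ((q : ℝ)⁻¹ * (1 + Real.log Z)) := by rw [sum_mul]
      _ ≤ (1 + Real.log Z) * ((q : ℝ)⁻¹ * (1 + Real.log Z)) := by gcongr; exact harm_le Z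
      _ = _ := by ring
  have hB : ∑ m ∈ Ioc 0 Z, ∑ n ∈ Ioc 0 Z, (if n < m ∧ (n : ZMod q) = m then ((m : ℝ)⁻¹ * (n : ℝ)⁻¹) else 0) = A := by
    rw [sum_comm, hA]
    refine sum_congr rfl fun m _ => sum_congr rfl fun n _ => ?_
    simp only [mul_comm, eq_comm (a := (m : ZMod q))]
  calc _ ≤ ∑ m ∈ Ioc 0 Z, ∑ n ∈ Ioc 0 Z, ((if m < n ∧ (n : ZMod q) = m then ((m : ℝ)⁻¹ * (n : ℝ)⁻¹) else 0)
        + (if n < m ∧ (n : ZMod q) = m then ((m : ℝ)⁻¹ * (n : ℝ)⁻¹) else 0)) := by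
        refine sum_le_sum fun m _ => sum_le_sum fun n _ => ?_
        have hp : (0 : ℝ) ≤ (m : ℝ)⁻¹ * (n : ℝ)⁻¹ := by positivity
        by_cases h : (n : ZMod q) = m
        · rcases lt_trichotomy m n with h' | h' | h'
          · simp [h, h', h'.ne', h'.not_gt]
          · simp [h']
          · simp [h, h', h'.ne, h'.not_gt]
        · simp [h]
    _ = A + A := by simp only [sum_add_distrib]; rw [hB]
    _ ≤ _ := by linarith

lemma mean_value {q : ℕ} [NeZero q] (hq : q.Prime) (Z : ℕ) (f : ArithmeticFunction ℂ) (B : ℝ)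
    (hB : ∀ n ∈ Ioc 0 Z, ‖f n‖ ≤ B) :
    |∑ χ : DirichletCharacter ℂ q, ‖Tw χ Z f‖ ^ 2 -
      ((q : ℝ) - 1) * ∑ n ∈ Ioc 0 Z with ¬ q ∣ n, ‖f n‖ ^ 2 / (n : ℝ) ^ 2| ≤
      2 * B ^ 2 * (1 + Real.log Z) ^ 2 := by
  have htot : (q.totient : ℂ) = (q : ℂ) - 1 := by
    rw [Nat.totient_prime hq, Nat.cast_sub hq.one_lt.le]; simp
  have hq1 : (1 : ℝ) < q := by exact_mod_cast hq.one_lt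
  have hunit : ∀ n : ℕ, IsUnit (n : ZMod q) ↔ ¬ q ∣ n := by
    intro n
    rw [ZMod.isUnit_iff_coprime, Nat.coprime_comm, Nat.Prime.coprime_iff_not_dvd hq]
  set g : ℕ → ℂ := fun n => f n / n with hg
  have e1 : ((∑ χ : DirichletCharacter ℂ q, ‖Tw χ Z f‖ ^ 2 : ℝ) : ℂ) =
      ∑ m ∈ Ioc 0 Z, ∑ n ∈ Ioc 0 Z, g m * star (g n) *
        (if (n : ZMod q) = m ∧ IsUnit (n : ZMod q) then ((q : ℂ) - 1) else 0) := by
    push_cast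
    have : ∀ χ : DirichletCharacter ℂ q, ((‖Tw χ Z f‖ : ℂ)) ^ 2 =
        ∑ m ∈ Ioc 0 Z, ∑ n ∈ Ioc 0 Z, g m * star (g n) * (χ (m : ZMod q) * star (χ (n : ZMod q))) := by
      intro χ
      rw [← Complex.mul_conj', Tw, map_sum, sum_mul_sum]
      refine sum_congr rfl fun m _ => sum_congr rfl fun n _ => ?_
      rw [hg]
      simp only [map_mul, map_div₀, Complex.star_def, Complex.conj_natCast]
      ring
    simp_rw [this]
    rw [sum_comm]
    refine sum_congr rfl fun m _ => ?_
    rw [sum_comm]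
    refine sum_congr rfl fun n _ => ?_
    rw [← mul_sum, orth, htot]
  have e2 : (((((q : ℝ) - 1) * ∑ n ∈ Ioc 0 Z with ¬ q ∣ n, ‖f n‖ ^ 2 / (n : ℝ) ^ 2 : ℝ)) : ℂ) =
      ∑ m ∈ Ioc 0 Z, ∑ n ∈ Ioc 0 Z, g m * star (g n) *
        (if n = m ∧ IsUnit (n : ZMod q) then ((q : ℂ) - 1) else 0) := by
    push_cast
    rw [sum_filter, mul_sum]
    refine sum_congr rfl fun m hm => ?_
    rw [sum_eq_single m]
    · simp only [true_and, hunit]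
      split_ifs
      · ring
      · rw [hg]
        simp only [Complex.star_def, map_div₀, Complex.conj_natCast]
        rw [← Complex.mul_conj']
        ring
    · intro n _ hn
      simp [hn]
    · intro h; exact absurd hm h
  have e3 : ∀ x : ℝ, |x| = ‖(x : ℂ)‖ := fun x => by rw [Complex.norm_real, Real.norm_eq_abs]
  rw [e3, Complex.ofReal_sub, e1, e2, ← sum_sub_distrib]
  simp only [← sum_sub_distrib, ← mul_sub]
  calc _ ≤ ∑ m ∈ Ioc 0 Z, ∑ n ∈ Ioc 0 Z, (B ^ 2 * ((q : ℝ) - 1)) *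
        (if n ≠ m ∧ (n : ZMod q) = m then ((m : ℝ)⁻¹ * (n : ℝ)⁻¹) else 0) := by
        refine (norm_sum_le _ _).trans (sum_le_sum fun m hm => (norm_sum_le _ _).trans (sum_le_sum fun n hn => ?_))
        by_cases hnm : n = m
        · subst hnm; simp
        by_cases h1 : (n : ZMod q) = m
        · by_cases hu : IsUnit (n : ZMod q)
          · simp only [hnm, h1, h1 ▸ hu, and_self, if_true, false_and, if_false, sub_zero, ne_eq, not_false_eq_true, true_and]
            rw [norm_mul, norm_mul, norm_star]
            have h2 : ‖(q : ℂ) - 1‖ = (q : ℝ) - 1 := by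
              rw [show ((q : ℂ) - 1) = (((q : ℝ) - 1 : ℝ) : ℂ) by push_cast; rfl, Complex.norm_real,
                Real.norm_eq_abs, abs_of_pos (by linarith)]
            have h3 : ‖g m‖ ≤ B * (m : ℝ)⁻¹ := by
              rw [hg]; simp only [norm_div, Complex.norm_natCast]; rw [div_eq_mul_inv]
              gcongr; exact hB m hm
            have h4 : ‖g n‖ ≤ B * (n : ℝ)⁻¹ := by
              rw [hg]; simp only [norm_div, Complex.norm_natCast]; rw [div_eq_mul_inv]
              gcongr; exact hB n hn
            rw [h2]
            calc ‖g m‖ * ‖g n‖ * ((q : ℝ) - 1) ≤ (B * (m : ℝ)⁻¹) * (B * (n : ℝ)⁻¹) * ((q : ℝ) - 1) := by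
                  have : 0 ≤ (q : ℝ) - 1 := by linarith
                  have := (norm_nonneg _).trans h3
                  gcongr
              _ = _ := by ring
          · have hp : 0 ≤ (B ^ 2 * ((q : ℝ) - 1)) := mul_nonneg (sq_nonneg _) (by linarith)
            simp only [hu, and_false, if_false, sub_zero, mul_zero, norm_zero]
            split_ifs <;> positivity
        · simp [h1, hnm]
    _ = (B ^ 2 * ((q : ℝ) - 1)) * ∑ m ∈ Ioc 0 Z, ∑ n ∈ Ioc 0 Z,
        (if n ≠ m ∧ (n : ZMod q) = m then ((m : ℝ)⁻¹ * (n : ℝ)⁻¹) else 0) := by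
        simp only [mul_sum]
    _ ≤ (B ^ 2 * ((q : ℝ) - 1)) * ((q : ℝ)⁻¹ * (2 * (1 + Real.log Z) ^ 2)) := by
        have hp : 0 ≤ (B ^ 2 * ((q : ℝ) - 1)) := mul_nonneg (sq_nonneg _) (by linarith)
        gcongr
        exact offdiag q Z hq.pos
    _ = ((q : ℝ) - 1) / q * (2 * B ^ 2 * (1 + Real.log Z) ^ 2) := by ring
    _ ≤ 1 * (2 * B ^ 2 * (1 + Real.log Z) ^ 2) := by
        gcongr
        rw [div_le_one (by linarith)]; linarith
    _ = _ := one_mul _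

lemma mean_value_tail {q : ℕ} [NeZero q] (hq : q.Prime) (N Z : ℕ) (hN : q ≤ N) (hNZ : N ≤ Z)
    (f : ArithmeticFunction ℂ) (B : ℝ)
    (hB : ∀ n ∈ Ioc 0 Z, ‖f n‖ ≤ B) (h0 : ∀ n ∈ Ioc 0 N, f n = 0) :
    ∑ χ : DirichletCharacter ℂ q, ‖Tw χ Z f‖ ^ 2 ≤ 3 * B ^ 2 * (1 + Real.log Z) ^ 2 := by
  have hmv := (abs_le.1 (mean_value hq Z f B hB)).2
  have hq1 : (1 : ℝ) < q := by exact_mod_cast hq.one_lt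
  have hN0 : 0 < N := hq.pos.trans_le hN
  have hlogZ : 0 ≤ Real.log Z := Real.log_natCast_nonneg Z
  have hd : ∑ n ∈ Ioc 0 Z with ¬ q ∣ n, ‖f n‖ ^ 2 / (n : ℝ) ^ 2 ≤ B ^ 2 * (N : ℝ)⁻¹ := by
    calc _ ≤ ∑ n ∈ Ioc 0 Z, ‖f n‖ ^ 2 / (n : ℝ) ^ 2 :=
          sum_le_sum_of_subset_of_nonneg (filter_subset _ _) fun _ _ _ => by positivity
      _ = ∑ n ∈ Ioc N Z, ‖f n‖ ^ 2 / (n : ℝ) ^ 2 := by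
          symm
          refine sum_subset (Ioc_subset_Ioc_left (by omega)) fun n hn hn' => ?_
          rw [h0 n (by simp only [mem_Ioc] at *; omega)]; simp
      _ ≤ ∑ n ∈ Ioc N Z, B ^ 2 * ((n : ℝ) ^ 2)⁻¹ := by
          refine sum_le_sum fun n hn => ?_
          rw [div_eq_mul_inv]
          gcongr
          exact hB n (by simp only [mem_Ioc] at *; omega)
      _ ≤ _ := by
          rw [← mul_sum]
          gcongr
          have := sum_Ioc_inv_sq_le_sub (α := ℝ) hN0.ne' hNZ
          have h2 : (0 : ℝ) ≤ (Z : ℝ)⁻¹ := by positivity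
          linarith
  have h3 : ((q : ℝ) - 1) * ∑ n ∈ Ioc 0 Z with ¬ q ∣ n, ‖f n‖ ^ 2 / (n : ℝ) ^ 2 ≤ B ^ 2 := by
    calc _ ≤ (N : ℝ) * (B ^ 2 * (N : ℝ)⁻¹) := by
          have : (q : ℝ) ≤ N := by exact_mod_cast hN
          apply mul_le_mul (by linarith) hd _ (by positivity)
          exact sum_nonneg fun _ _ => by positivity
      _ = B ^ 2 := by
          have : (N : ℝ) ≠ 0 := by positivity
          field_simp
  have h4 : B ^ 2 * 1 ≤ B ^ 2 * (1 + Real.log Z) ^ 2 := by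
    gcongr
    nlinarith
  linarith

end MomentProof

namespace MomentProof
open Finset Filter Topology

/-- Zeta as a complex arithmetic function. -/
noncomputable abbrev zC : ArithmeticFunction ℂ := chA (1 : DirichletCharacter ℂ 1)
/-- Von Mangoldt as a complex arithmetic function. -/
noncomputable abbrev lamC : ArithmeticFunction ℂ := LamT (1 : DirichletCharacter ℂ 1)
/-- Moebius as a complex arithmetic function. -/
noncomputable abbrev muC : ArithmeticFunction ℂ := ((ArithmeticFunction.moebius : ArithmeticFunction ℤ) : ArithmeticFunction ℂ)

lemma one_char_apply (n : ℕ) : (1 : DirichletCharacter ℂ 1) (n : ZMod 1) = 1 := by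
  rw [Subsingleton.elim (n : ZMod 1) 1, map_one]

lemma zC_apply {n : ℕ} (hn : n ≠ 0) : zC n = 1 := by
  rw [chA_apply, if_neg hn, one_char_apply]

lemma lamC_apply (n : ℕ) : lamC n = (Λ n : ℂ) := by
  rw [LamT_apply, one_char_apply, one_mul]

lemma zC_eq : zC = ((ArithmeticFunction.zeta : ArithmeticFunction ℕ) : ArithmeticFunction ℂ) := by
  ext n
  rcases eq_or_ne n 0 with rfl | hn
  · simp
  · rw [zC_apply hn]; simp [hn]

lemma zC_mul_muC : zC * muC = 1 := by
  rw [zC_eq]; exact coe_zeta_mul_coe_moebius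

lemma Dl_zC_mul_muC : Dl zC * muC = lamC := by
  rw [Dl_chA, mul_assoc, mul_comm lamC, ← mul_assoc, zC_mul_muC, one_mul]

lemma muC_norm (n : ℕ) : ‖muC n‖ ≤ 1 := by
  rw [show muC n = ((ArithmeticFunction.moebius n : ℤ) : ℂ) from rfl, Complex.norm_intCast]
  exact_mod_cast abs_moebius_le_one

lemma conv_trunc {N n : ℕ} (hn : n ≤ N) (f g : ArithmeticFunction ℂ) :
    (trunc N f * trunc N g) n = (f * g) n := by
  rcases eq_or_ne n 0 with rfl | hn0
  · simp
  rw [ArithmeticFunction.mul_apply, ArithmeticFunction.mul_apply]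
  refine sum_congr rfl fun p hp => ?_
  have h1 := Nat.divisor_le (Nat.fst_mem_divisors_of_mem_antidiagonal hp)
  have h2 := Nat.divisor_le (Nat.snd_mem_divisors_of_mem_antidiagonal hp)
  rw [trunc_apply, trunc_apply, if_pos (by omega), if_pos (by omega)]

lemma trunc_norm {N : ℕ} {f : ArithmeticFunction ℂ} {A : ℝ} (hA : 0 ≤ A)
    (hf : ∀ n ≤ N, ‖f n‖ ≤ A) (n : ℕ) : ‖trunc N f n‖ ≤ A := by
  rw [trunc_apply]; split_ifs with h
  · exact hf n h
  · simpa using hA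

lemma conv_bound {f g : ArithmeticFunction ℂ} {A B : ℝ} (hA : 0 ≤ A) 
    (hf : ∀ n, ‖f n‖ ≤ A) (hg : ∀ n, ‖g n‖ ≤ B) (n : ℕ) :
    ‖(f * g) n‖ ≤ A * B * n.divisors.card := by
  rw [ArithmeticFunction.mul_apply]
  refine (norm_sum_le _ _).trans ?_
  calc _ ≤ ∑ p ∈ n.divisorsAntidiagonal, A * B := by
        refine sum_le_sum fun p _ => ?_
        rw [norm_mul]
        exact mul_le_mul (hf _) (hg _) (norm_nonneg _) hA
    _ = _ := by
        rw [sum_const, nsmul_eq_mul, ← Nat.map_div_right_divisors, card_map]; ring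

lemma Tw_neg {q : ℕ} (χ : DirichletCharacter ℂ q) (Z : ℕ) (f : ArithmeticFunction ℂ) :
    Tw χ Z (-f) = - Tw χ Z f := by
  unfold Tw
  rw [← sum_neg_distrib]
  refine sum_congr rfl fun n hn => ?_
  rw [ArithmeticFunction.neg_apply]; ring

lemma Tw_one {q : ℕ} (χ : DirichletCharacter ℂ q) (Z : ℕ) (hZ : 1 ≤ Z) :
    Tw χ Z 1 = 1 := by
  unfold Tw
  rw [sum_eq_single 1]
  · simp
  · intro n _ hn
    rw [ArithmeticFunction.one_apply_ne hn, zero_mul]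
  · intro h; exact absurd (mem_Ioc.2 ⟨one_pos, hZ⟩) h

lemma SN_one {q : ℕ} (χ : DirichletCharacter ℂ q) (N : ℕ) : SN χ N 1 = Tw χ N zC := by
  unfold SN Tw
  refine sum_congr rfl fun n hn => ?_
  rw [zC_apply (mem_Ioc.1 hn).1.ne', Complex.cpow_neg_one, one_mul, div_eq_mul_inv]

lemma SN_deriv_one {q : ℕ} (χ : DirichletCharacter ℂ q) (N : ℕ) :
    deriv (SN χ N) 1 = - Tw χ N (Dl zC) := by
  have h : HasDerivAt (SN χ N) (∑ n ∈ Ioc 0 N, χ (n : ZMod q) *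
      ((n : ℂ) ^ (-(1 : ℂ)) * Complex.log n * (-1))) 1 := by
    unfold SN
    refine HasDerivAt.fun_sum fun n hn => ?_
    refine HasDerivAt.const_mul _ ?_
    have hn0 : (n : ℂ) ≠ 0 := by exact_mod_cast (mem_Ioc.1 hn).1.ne'
    exact HasDerivAt.const_cpow (hasDerivAt_neg' (1 : ℂ)) (Or.inl hn0)
  rw [h.deriv, Tw, ← sum_neg_distrib]
  refine sum_congr rfl fun n hn => ?_
  rw [Dl_apply, zC_apply (mem_Ioc.1 hn).1.ne', Complex.cpow_neg_one, Complex.natCast_log]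
  ring

lemma approx {q : ℕ} [NeZero q] (χ : DirichletCharacter ℂ q) (hχ : χ ≠ 1) :
    ‖DirichletCharacter.LFunction χ 1 - SN χ (q ^ 4) 1‖ ≤ 18 / q ∧
    ‖deriv (DirichletCharacter.LFunction χ) 1 - deriv (SN χ (q ^ 4)) 1‖ ≤ 18 / q := by
  have hq : (1 : ℝ) ≤ q := by exact_mod_cast Nat.one_le_iff_ne_zero.2 (NeZero.ne q)
  have hq0 : (0 : ℝ) < q := by linarith
  have key : ∀ s : ℂ, ‖s - 1‖ ≤ 1 / 2 →
      ‖DirichletCharacter.LFunction χ s - SN χ (q ^ 4) s‖ ≤ 9 / q := by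
    intro s hs
    have hre : 1 / 2 ≤ s.re := by
      have := (abs_le.1 ((Complex.abs_re_le_norm (s - 1)).trans hs)).1
      simp at this; linarith
    have hn : ‖s‖ ≤ 3 / 2 := by
      calc ‖s‖ = ‖(s - 1) + 1‖ := by ring_nf
        _ ≤ ‖s - 1‖ + ‖(1 : ℂ)‖ := norm_add_le _ _
        _ ≤ _ := by norm_num; linarith
    refine (L_sub_SN χ hχ (s := s) (by linarith) (q ^ 4)).trans ?_
    have h1 : ‖s‖ / s.re ≤ 3 := by rw [div_le_iff₀ (by linarith)]; linarith
    have h2 : ((q ^ 4 + 1 : ℕ) : ℝ) ^ (-s.re) ≤ ((q : ℝ) ^ 2)⁻¹ := by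
      calc ((q ^ 4 + 1 : ℕ) : ℝ) ^ (-s.re) ≤ ((q ^ 4 + 1 : ℕ) : ℝ) ^ (-(1 / 2 : ℝ)) := by
            apply Real.rpow_le_rpow_of_exponent_le
            · push_cast; have : (0 : ℝ) ≤ (q : ℝ) ^ 4 := by positivity
              linarith
            · linarith
        _ ≤ ((q : ℝ) ^ 4) ^ (-(1 / 2 : ℝ)) := by
            apply Real.rpow_le_rpow_of_nonpos (by positivity) _ (by norm_num)
            push_cast; linarith
        _ = _ := by
            rw [Real.rpow_neg (by positivity), ← Real.rpow_natCast, ← Real.rpow_mul (by positivity)]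
            norm_num
    calc _ ≤ 3 * q * 3 * ((q : ℝ) ^ 2)⁻¹ := by gcongr
      _ = 9 / q := by field_simp; norm_num
  constructor
  · refine (key 1 (by norm_num)).trans ?_
    gcongr; norm_num
  · have hd : Differentiable ℂ (fun s => DirichletCharacter.LFunction χ s - SN χ (q ^ 4) s) :=
      (DirichletCharacter.differentiable_LFunction hχ).sub (SN_differentiable χ _)
    have := Complex.norm_deriv_le_of_forall_mem_sphere_norm_le (c := 1) (R := 1 / 2) (C := 9 / q)
      (by norm_num) hd.diffContOnCl (fun z hz => key z (by
        rw [mem_sphere_iff_norm] at hz; exact hz.le))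
    rw [deriv_fun_sub ((DirichletCharacter.differentiable_LFunction hχ) 1) (SN_differentiable χ _ 1)] at this
    refine this.trans (le_of_eq ?_)
    ring

lemma Tw_norm {q : ℕ} (χ : DirichletCharacter ℂ q) (Z : ℕ) (f : ArithmeticFunction ℂ) (A : ℝ)
    (hA : 0 ≤ A) (hf : ∀ n ∈ Ioc 0 Z, ‖f n‖ ≤ A) : ‖Tw χ Z f‖ ≤ A * (1 + Real.log Z) := by
  unfold Tw
  refine (norm_sum_le _ _).trans ?_
  calc _ ≤ ∑ n ∈ Ioc 0 Z, A * (n : ℝ)⁻¹ := by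
        refine sum_le_sum fun n hn => ?_
        rw [norm_mul, norm_div, Complex.norm_natCast, div_eq_mul_inv]
        have h1 := χ.norm_le_one (n : ZMod q)
        have h2 := hf n hn
        calc ‖f n‖ * (‖χ (n : ZMod q)‖ * (n : ℝ)⁻¹) ≤ A * (1 * (n : ℝ)⁻¹) := by gcongr
          _ = _ := by ring
    _ ≤ _ := by rw [← mul_sum]; gcongr; exact harm_le Z

lemma card_char (q : ℕ) [NeZero q] : ((univ : Finset (DirichletCharacter ℂ q)).card : ℝ) ≤ q := by
  rw [card_univ, ← Nat.card_eq_fintype_card, DirichletCharacter.card_eq_totient_of_hasEnoughRootsOfUnity]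
  exact_mod_cast Nat.totient_le q

lemma sum_sq_split {q : ℕ} [NeZero q] (u v : DirichletCharacter ℂ q → ℂ) (X Y : ℝ)
    (hu : ∀ χ, χ ≠ 1 → ‖u χ‖ ≤ X / q) (hv : ∑ χ, ‖v χ‖ ^ 2 ≤ Y) :
    ∑ χ : DirichletCharacter ℂ q with χ ≠ 1, ‖u χ + v χ‖ ^ 2 ≤ 2 * X ^ 2 + 2 * Y := by
  have hq : (1 : ℝ) ≤ q := by exact_mod_cast Nat.one_le_iff_ne_zero.2 (NeZero.ne q)
  calc _ ≤ ∑ χ : DirichletCharacter ℂ q with χ ≠ 1, (2 * (X / q) ^ 2 + 2 * ‖v χ‖ ^ 2) := by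
        refine sum_le_sum fun χ hχ => ?_
        have h1 := hu χ (mem_filter.1 hχ).2
        have h2 := norm_add_le (u χ) (v χ)
        have h3 : ‖u χ‖ ^ 2 ≤ (X / q) ^ 2 := by gcongr
        have h4 : ‖u χ + v χ‖ ^ 2 ≤ (‖u χ‖ + ‖v χ‖) ^ 2 := by gcongr
        nlinarith [sq_nonneg (‖u χ‖ - ‖v χ‖)]
    _ ≤ ∑ χ : DirichletCharacter ℂ q, (2 * (X / q) ^ 2 + 2 * ‖v χ‖ ^ 2) :=
        sum_le_sum_of_subset_of_nonneg (filter_subset _ _) fun _ _ _ => by positivity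
    _ = (univ : Finset (DirichletCharacter ℂ q)).card * (2 * (X / q) ^ 2) + 2 * ∑ χ, ‖v χ‖ ^ 2 := by
        rw [sum_add_distrib, sum_const, nsmul_eq_mul, mul_sum]
    _ ≤ (q : ℝ) * (2 * (X / q) ^ 2) + 2 * Y := by gcongr; exact_mod_cast card_char q
    _ = 2 * X ^ 2 / q + 2 * Y := by field_simp
    _ ≤ _ := by
        gcongr
        exact div_le_self (by positivity) hq

lemma tail_poly (η : ℝ) (hη : 0 < η) :
    ∃ C : ℝ, 0 < C ∧ ∀ (q : ℕ) [NeZero q], q.Prime → ∀ f : ArithmeticFunction ℂ,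
      (∀ n ∈ Ioc 0 (q ^ 4), f n = 0) →
      (∀ n ∈ Ioc 0 (q ^ 4 * q ^ 4), ‖f n‖ ≤ 2 * (1 + 8 * Real.log q) * n.divisors.card) →
      ∑ χ : DirichletCharacter ℂ q, ‖Tw χ (q ^ 4 * q ^ 4) f‖ ^ 2 ≤ C * (q : ℝ) ^ η := by
  obtain ⟨C, hC, HC⟩ := divisor_bound (η / 17) (by positivity)
  obtain ⟨C', hC', HC'⟩ := log_le_pow (η / 17) (by positivity) 4 8 (by norm_num)
  refine ⟨12 * C ^ 2 * C', by positivity, fun q _ hq f h0 hf => ?_⟩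
  have hq1 : (1 : ℝ) ≤ q := by exact_mod_cast hq.one_lt.le
  have hlq : 0 ≤ Real.log q := Real.log_nonneg hq1
  set B : ℝ := 2 * (1 + 8 * Real.log q) * (C * (q : ℝ) ^ (8 * (η / 17))) with hB
  have h1 := mean_value_tail hq (q ^ 4) (q ^ 4 * q ^ 4) (Nat.le_self_pow (by norm_num) q)
    (Nat.le_mul_of_pos_left _ (pow_pos hq.pos 4)) f B ?_ h0
  · refine h1.trans ?_
    have hl : Real.log ((q ^ 4 * q ^ 4 : ℕ) : ℝ) = 8 * Real.log q := by
      push_cast; rw [← pow_add, Real.log_pow]; norm_num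
    rw [hl, hB]
    have h2 := HC' q hq1
    calc _ = 12 * C ^ 2 * (1 + 8 * Real.log q) ^ 4 * ((q : ℝ) ^ (8 * (η / 17)) * (q : ℝ) ^ (8 * (η / 17))) := by ring
      _ ≤ 12 * C ^ 2 * (C' * (q : ℝ) ^ (η / 17)) * ((q : ℝ) ^ (8 * (η / 17)) * (q : ℝ) ^ (8 * (η / 17))) := by gcongr
      _ = 12 * C ^ 2 * C' * ((q : ℝ) ^ (η / 17) * ((q : ℝ) ^ (8 * (η / 17)) * (q : ℝ) ^ (8 * (η / 17)))) := by ring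
      _ = _ := by
        rw [← Real.rpow_add (by linarith), ← Real.rpow_add (by linarith)]; ring_nf
  · intro n hn
    refine (hf n hn).trans ?_
    obtain ⟨hn1, hn2⟩ := mem_Ioc.1 hn
    rw [hB]
    gcongr
    refine (HC n hn1.ne').trans ?_
    gcongr
    calc (n : ℝ) ^ (η / 17) ≤ ((q : ℝ) ^ (8 : ℝ)) ^ (η / 17) := by
          gcongr
          have : (n : ℝ) ≤ (q : ℝ) ^ 4 * (q : ℝ) ^ 4 := by exact_mod_cast hn2
          refine this.trans (le_of_eq ?_)
          rw [← pow_add, ← Real.rpow_natCast]; norm_num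
      _ = _ := by rw [← Real.rpow_mul (by linarith)]

lemma mollify (η : ℝ) (hη : 0 < η) :
    ∃ C : ℝ, 0 < C ∧ ∀ (q : ℕ) [NeZero q], q.Prime →
      ∑ χ : DirichletCharacter ℂ q with χ ≠ 1,
        ‖DirichletCharacter.LFunction χ 1 * Tw χ (q ^ 4) muC - 1‖ ^ 2 ≤ C * (q : ℝ) ^ η ∧
      ∑ χ : DirichletCharacter ℂ q with χ ≠ 1,
        ‖deriv (DirichletCharacter.LFunction χ) 1 * Tw χ (q ^ 4) muC + Tw χ (q ^ 4) lamC‖ ^ 2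
          ≤ C * (q : ℝ) ^ η := by
  obtain ⟨C, hC, HC⟩ := tail_poly η hη
  obtain ⟨C', hC', HC'⟩ := log_le_pow η hη 2 4 (by norm_num)
  refine ⟨2 * 18 ^ 2 * C' + 2 * C, by positivity, fun q _ hq => ?_⟩
  have hq1 : (1 : ℝ) ≤ q := by exact_mod_cast hq.one_lt.le
  have hlq : 0 ≤ Real.log q := Real.log_nonneg hq1
  have hl : Real.log ((q ^ 4 : ℕ) : ℝ) = 4 * Real.log q := by
    push_cast; rw [Real.log_pow]; norm_num
  have hM : ∀ χ : DirichletCharacter ℂ q, ‖Tw χ (q ^ 4) muC‖ ≤ 1 + 4 * Real.log q := by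
    intro χ
    have := Tw_norm χ (q ^ 4) muC 1 zero_le_one (fun n _ => muC_norm n)
    rwa [hl, one_mul] at this
  have hfin : 2 * (18 * (1 + 4 * Real.log q)) ^ 2 + 2 * (C * (q : ℝ) ^ η) ≤ (2 * 18 ^ 2 * C' + 2 * C) * (q : ℝ) ^ η := by
    have := HC' q hq1
    nlinarith
  have hd1 : ∀ n : ℕ, n ≠ 0 → (1 : ℝ) ≤ n.divisors.card := by
    intro n hn
    have h : 0 < n.divisors.card := card_pos.2 ⟨1, by simp [hn]⟩
    exact_mod_cast h
  have hN1 : 1 ≤ q ^ 4 * q ^ 4 := Nat.mul_pos (pow_pos hq.pos 4) (pow_pos hq.pos 4)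
  have htz : ∀ (f : ArithmeticFunction ℂ) n, q ^ 4 < n → trunc (q ^ 4) f n = 0 := by
    intro f n hn; rw [trunc_apply, if_neg (by omega)]
  have hlog : ∀ n : ℕ, n ≤ q ^ 4 → Real.log n ≤ 4 * Real.log q := by
    intro n hn
    rcases Nat.eq_zero_or_pos n with rfl | h
    · simp; exact hlq
    · rw [← hl]; exact Real.log_le_log (by exact_mod_cast h) (by exact_mod_cast hn)
  have hmu : ∀ n, ‖trunc (q ^ 4) muC n‖ ≤ 1 := trunc_norm zero_le_one fun n _ => muC_norm n
  constructor
  · refine le_trans ?_ hfin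
    refine le_trans (le_of_eq ?_) (sum_sq_split (q := q)
      (fun χ : DirichletCharacter ℂ q => (DirichletCharacter.LFunction χ 1 - SN χ (q ^ 4) 1) * Tw χ (q ^ 4) muC)
      (fun χ => Tw χ (q ^ 4 * q ^ 4) (trunc (q ^ 4) zC * trunc (q ^ 4) muC + -1))
      (18 * (1 + 4 * Real.log q)) (C * (q : ℝ) ^ η) ?_ ?_)
    · refine sum_congr rfl fun χ _ => ?_
      congr 2
      rw [Tw_add, Tw_neg, Tw_one _ _ hN1, ← Tw_mul _ _ _ _ _ (htz _) (htz _), Tw_trunc, Tw_trunc, SN_one]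
      ring
    · intro χ hχ
      rw [norm_mul]
      calc _ ≤ 18 / (q : ℝ) * (1 + 4 * Real.log q) := by
            gcongr
            · exact (approx χ hχ).1
            · exact hM χ
        _ = _ := by ring
    · apply HC q hq
      · intro n hn
        rw [ArithmeticFunction.add_apply, conv_trunc (mem_Ioc.1 hn).2, zC_mul_muC, ArithmeticFunction.neg_apply]
        ring
      · intro n hn
        have hn0 := (mem_Ioc.1 hn).1.ne'
        rw [ArithmeticFunction.add_apply, ArithmeticFunction.neg_apply]
        have h1 := conv_bound zero_le_one (trunc_norm (N := q ^ 4) (f := zC) zero_le_one (fun n _ => by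
          rcases eq_or_ne n 0 with rfl | h
          · simp
          · rw [zC_apply h]; simp)) hmu n
        have h2 : ‖-((1 : ArithmeticFunction ℂ) n)‖ ≤ 1 := by
          rw [ArithmeticFunction.one_apply]; split_ifs <;> simp
        have := hd1 n hn0
        calc _ ≤ _ := norm_add_le _ _
          _ ≤ 2 * 1 * (n.divisors.card : ℝ) := by linarith
          _ ≤ _ := by gcongr; linarith
  · refine le_trans ?_ hfin
    refine le_trans (le_of_eq ?_) (sum_sq_split (q := q)
      (fun χ => (deriv (DirichletCharacter.LFunction χ) 1 - deriv (SN χ (q ^ 4)) 1) * Tw χ (q ^ 4) muC)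
      (fun χ => Tw χ (q ^ 4 * q ^ 4) (-(trunc (q ^ 4) (Dl zC) * trunc (q ^ 4) muC) + trunc (q ^ 4) lamC))
      (18 * (1 + 4 * Real.log q)) (C * (q : ℝ) ^ η) ?_ ?_)
    · refine sum_congr rfl fun χ _ => ?_
      congr 2
      rw [Tw_add, Tw_neg, ← Tw_mul _ _ _ _ _ (htz _) (htz _),
        ← Tw_mono χ (Nat.le_mul_of_pos_left (q ^ 4) (pow_pos hq.pos 4)) (trunc (q ^ 4) lamC) (htz _),
        Tw_trunc, Tw_trunc, Tw_trunc, SN_deriv_one]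
      ring
    · intro χ hχ
      rw [norm_mul]
      calc _ ≤ 18 / (q : ℝ) * (1 + 4 * Real.log q) := by
            gcongr
            · exact (approx χ hχ).2
            · exact hM χ
        _ = _ := by ring
    · apply HC q hq
      · intro n hn
        rw [ArithmeticFunction.add_apply, ArithmeticFunction.neg_apply, conv_trunc (mem_Ioc.1 hn).2, Dl_zC_mul_muC, trunc_apply,
          if_pos (mem_Ioc.1 hn).2]
        ring
      · intro n hn
        have hn0 := (mem_Ioc.1 hn).1.ne'
        rw [ArithmeticFunction.add_apply, ArithmeticFunction.neg_apply]
        have h4 : 0 ≤ 4 * Real.log q := by positivity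
        have h1 := conv_bound h4 (trunc_norm (N := q ^ 4) (f := Dl zC) h4 (fun n hn => by
          rcases eq_or_ne n 0 with rfl | h
          · simpa using hlq
          · rw [Dl_apply, zC_apply h, one_mul, Complex.norm_real, Real.norm_eq_abs, abs_of_nonneg (Real.log_natCast_nonneg n)]
            exact hlog n hn)) hmu n
        have h2 := trunc_norm (N := q ^ 4) (f := lamC) h4 (fun n hn => by
          rw [lamC_apply, Complex.norm_real, Real.norm_eq_abs, abs_of_nonneg vonMangoldt_nonneg]
          exact vonMangoldt_le_log.trans (hlog n hn)) n
        have := hd1 n hn0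
        calc _ ≤ _ := norm_add_le _ _
          _ ≤ 2 * (4 * Real.log q) * (n.divisors.card : ℝ) := by rw [norm_neg]; nlinarith
          _ ≤ _ := by gcongr; linarith

end MomentProof

namespace MomentProof
open Finset Filter Topology

lemma vK_nonneg (k n : ℕ) : 0 ≤ (vonMangoldt ^ k : ArithmeticFunction ℝ) n := by
  induction k generalizing n with
  | zero =>
    rw [pow_zero, ArithmeticFunction.one_apply]; split_ifs <;> norm_num
  | succ k ih =>
    rw [pow_succ, ArithmeticFunction.mul_apply]
    exact sum_nonneg fun p _ => mul_nonneg (ih _) vonMangoldt_nonneg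

lemma vK_le (k n : ℕ) : (vonMangoldt ^ k : ArithmeticFunction ℝ) n ≤ Real.log n ^ k := by
  induction k generalizing n with
  | zero =>
    rw [pow_zero, pow_zero, ArithmeticFunction.one_apply]; split_ifs <;> norm_num
  | succ k ih =>
    rw [pow_succ, ArithmeticFunction.mul_apply]
    calc _ ≤ ∑ p ∈ n.divisorsAntidiagonal, Real.log n ^ k * vonMangoldt p.2 := by
          refine sum_le_sum fun p hp => ?_
          have h1 := Nat.divisor_le (Nat.fst_mem_divisors_of_mem_antidiagonal hp)
          have h2 := Nat.pos_of_mem_divisors (Nat.fst_mem_divisors_of_mem_antidiagonal hp)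
          refine mul_le_mul_of_nonneg_right ((ih _).trans ?_) vonMangoldt_nonneg
          have h3 : Real.log p.1 ≤ Real.log n :=
            Real.log_le_log (by exact_mod_cast h2) (by exact_mod_cast h1)
          exact pow_le_pow_left₀ (Real.log_natCast_nonneg _) h3 _
      _ = _ := by
          rw [← mul_sum, Nat.sum_divisorsAntidiagonal' (fun _ b => vonMangoldt b), vonMangoldt_sum, pow_succ]

lemma truncpow_norm (N k n : ℕ) :
    ‖((trunc N lamC) ^ k) n‖ ≤ (vonMangoldt ^ k : ArithmeticFunction ℝ) n := by
  induction k generalizing n with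
  | zero =>
    rw [pow_zero, pow_zero, ArithmeticFunction.one_apply, ArithmeticFunction.one_apply]
    split_ifs <;> simp
  | succ k ih =>
    rw [pow_succ, pow_succ, ArithmeticFunction.mul_apply, ArithmeticFunction.mul_apply]
    refine (norm_sum_le _ _).trans (sum_le_sum fun p _ => ?_)
    rw [norm_mul]
    refine mul_le_mul (ih _) ?_ (norm_nonneg _) (vK_nonneg _ _)
    rw [trunc_apply]; split_ifs
    · rw [lamC_apply, Complex.norm_real, Real.norm_eq_abs, abs_of_nonneg vonMangoldt_nonneg]
    · simp

lemma truncpow_eq (N k n : ℕ) (hn : n ≤ N) :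
    ((trunc N lamC) ^ k) n = (((vonMangoldt ^ k : ArithmeticFunction ℝ) n : ℝ) : ℂ) := by
  induction k generalizing n with
  | zero =>
    rw [pow_zero, pow_zero, ArithmeticFunction.one_apply, ArithmeticFunction.one_apply]
    split_ifs <;> simp
  | succ k ih =>
    rw [pow_succ, pow_succ, ArithmeticFunction.mul_apply, ArithmeticFunction.mul_apply]
    push_cast
    refine sum_congr rfl fun p hp => ?_
    have h1 := Nat.divisor_le (Nat.fst_mem_divisors_of_mem_antidiagonal hp)
    have h2 := Nat.divisor_le (Nat.snd_mem_divisors_of_mem_antidiagonal hp)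
    rw [ih _ (by omega), trunc_apply, if_pos (by omega), lamC_apply]

lemma truncpow_supp (N k n : ℕ) (f : ArithmeticFunction ℂ) (hn : N ^ k < n) :
    ((trunc N f) ^ k) n = 0 := by
  induction k generalizing n with
  | zero =>
    rw [pow_zero, ArithmeticFunction.one_apply_ne]
    rw [pow_zero] at hn; omega
  | succ k ih =>
    rw [pow_succ, ArithmeticFunction.mul_apply]
    refine sum_eq_zero fun p hp => ?_
    by_cases h1 : N ^ k < p.1
    · rw [ih _ h1, zero_mul]
    · have h2 : N < p.2 := by
        by_contra h
        have := Nat.mul_le_mul (not_lt.1 h1) (not_lt.1 h)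
        rw [(Nat.mem_divisorsAntidiagonal.1 hp).1, ← pow_succ] at this
        omega
      rw [trunc_apply, if_neg (by omega), mul_zero]

lemma Tw_pow {q : ℕ} (χ : DirichletCharacter ℂ q) (N k : ℕ) (f : ArithmeticFunction ℂ) :
    Tw χ N f ^ k = Tw χ (N ^ k) ((trunc N f) ^ k) := by
  induction k with
  | zero => rw [pow_zero, pow_zero, pow_zero, Tw_one _ _ le_rfl]
  | succ k ih =>
    rw [pow_succ, pow_succ, pow_succ, ih, ← Tw_trunc χ N f, Tw_mul]
    · intro n hn; exact truncpow_supp N k n f hn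
    · intro n hn; rw [trunc_apply, if_neg (by omega)]

/-- Terms of the series defining `momentConst`. -/
noncomputable def mT (k n : ℕ) : ℝ := (vonMangoldtConv k n) ^ 2 / (n : ℝ) ^ 2

lemma mT_nonneg (k n : ℕ) : 0 ≤ mT k n := by unfold mT; positivity

lemma mT_le (k : ℕ) : ∃ C : ℝ, 0 < C ∧ ∀ n : ℕ, mT k n ≤ C * (n : ℝ) ^ (-(7 / 4) : ℝ) := by
  obtain ⟨C, hC, HC⟩ := log_le_pow (1 / 4) (by norm_num) (2 * k) 1 (by norm_num)
  refine ⟨C, hC, fun n => ?_⟩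
  rcases Nat.eq_zero_or_pos n with rfl | hn
  · unfold mT; simp
  have hn1 : (1 : ℝ) ≤ n := by exact_mod_cast hn
  have h1 : (vonMangoldtConv k n) ^ 2 ≤ C * (n : ℝ) ^ (1 / 4 : ℝ) := by
    refine le_trans ?_ (HC n hn1)
    have h2 := vK_le k n
    have h3 := vK_nonneg k n
    have h4 := Real.log_natCast_nonneg n
    calc (vonMangoldtConv k n) ^ 2 ≤ (Real.log n ^ k) ^ 2 := by
          exact pow_le_pow_left₀ h3 h2 2
      _ = Real.log n ^ (2 * k) := by rw [← pow_mul, mul_comm]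
      _ ≤ _ := by gcongr; linarith
  unfold mT
  rw [div_le_iff₀ (by positivity)]
  refine h1.trans (le_of_eq ?_)
  rw [mul_assoc, ← Real.rpow_natCast (n : ℝ) 2, ← Real.rpow_add (by linarith)]
  norm_num

lemma mT_summable (k : ℕ) : Summable (mT k) := by
  obtain ⟨C, hC, HC⟩ := mT_le k
  exact Summable.of_nonneg_of_le (mT_nonneg k) HC
    ((Real.summable_nat_rpow.2 (by norm_num)).mul_left C)

lemma mT_tail (k : ℕ) : ∃ C : ℝ, 0 < C ∧ ∀ q : ℕ, 1 ≤ q →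
    (q : ℝ) * (momentConst k - ∑ n ∈ range q, mT k n) ≤ C * (q : ℝ) ^ (1 / 2 : ℝ) := by
  obtain ⟨C, hC, HC⟩ := mT_le k
  have hs : Summable (fun n : ℕ => (n : ℝ) ^ (-(5 / 4) : ℝ)) := Real.summable_nat_rpow.2 (by norm_num)
  have hs0 : 0 ≤ ∑' n : ℕ, (n : ℝ) ^ (-(5 / 4) : ℝ) := tsum_nonneg fun n => by positivity
  refine ⟨C * (∑' n : ℕ, (n : ℝ) ^ (-(5 / 4) : ℝ)) + 1, by positivity, fun q hq => ?_⟩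
  have hq0 : (0 : ℝ) < q := by exact_mod_cast hq
  have e1 : momentConst k = ∑' n, mT k n := rfl
  have e2 := (mT_summable k).sum_add_tsum_nat_add q
  have hs' := (summable_nat_add_iff (f := fun n : ℕ => (n : ℝ) ^ (-(5 / 4) : ℝ)) q).2 hs
  have e3 : ∑' n, mT k (n + q) ≤
      C * (q : ℝ) ^ (-(1 / 2) : ℝ) * ∑' n : ℕ, ((n + q : ℕ) : ℝ) ^ (-(5 / 4) : ℝ) := by
    rw [← tsum_mul_left]
    refine Summable.tsum_le_tsum (fun n => ?_) ((summable_nat_add_iff q).2 (mT_summable k))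
      (hs'.mul_left _)
    refine (HC _).trans ?_
    have hp : (0 : ℝ) < ((n + q : ℕ) : ℝ) := by push_cast; positivity
    rw [show (-(7 / 4) : ℝ) = -(1 / 2) + -(5 / 4) by norm_num, Real.rpow_add hp, ← mul_assoc]
    gcongr ?_ * _
    gcongr C * ?_
    apply Real.rpow_le_rpow_of_nonpos hq0 _ (by norm_num)
    push_cast
    have : (0 : ℝ) ≤ n := by positivity
    linarith
  have e4 : ∑' n : ℕ, ((n + q : ℕ) : ℝ) ^ (-(5 / 4) : ℝ) ≤ ∑' n : ℕ, (n : ℝ) ^ (-(5 / 4) : ℝ) := by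
    have := hs.sum_add_tsum_nat_add q
    have h0 : 0 ≤ ∑ n ∈ range q, (n : ℝ) ^ (-(5 / 4) : ℝ) := sum_nonneg fun n _ => by positivity
    linarith
  have e5 : momentConst k - ∑ n ∈ range q, mT k n = ∑' n, mT k (n + q) := by
    rw [e1]; linarith
  rw [e5]
  calc (q : ℝ) * ∑' n, mT k (n + q)
      ≤ q * (C * (q : ℝ) ^ (-(1 / 2) : ℝ) * ∑' n : ℕ, (n : ℝ) ^ (-(5 / 4) : ℝ)) := by
        gcongr
        refine e3.trans ?_
        gcongr
    _ = C * (∑' n : ℕ, (n : ℝ) ^ (-(5 / 4) : ℝ)) * ((q : ℝ) ^ (1 : ℝ) * (q : ℝ) ^ (-(1 / 2) : ℝ)) := by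
        rw [Real.rpow_one]; ring
    _ = C * (∑' n : ℕ, (n : ℝ) ^ (-(5 / 4) : ℝ)) * (q : ℝ) ^ (1 / 2 : ℝ) := by
        rw [← Real.rpow_add hq0]; norm_num
    _ ≤ _ := by
        gcongr; linarith

lemma P_moment (k : ℕ) (hk : 1 ≤ k) : ∃ C : ℝ, 0 < C ∧ ∀ (q : ℕ) [NeZero q], q.Prime →
    |∑ χ : DirichletCharacter ℂ q, ‖Tw χ (q ^ 4) lamC‖ ^ (2 * k) - ((q : ℝ) - 1) * momentConst k|
      ≤ C * (q : ℝ) ^ (1 / 2 : ℝ) := by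
  obtain ⟨C, hC, HC⟩ := mT_tail k
  obtain ⟨C', hC', HC'⟩ := log_le_pow (1 / 2) (by norm_num) (2 * k + 2) (4 * k) (by positivity)
  refine ⟨2 * C' + C, by positivity, fun q _ hq => ?_⟩
  have hq1 : (1 : ℝ) ≤ q := by exact_mod_cast hq.one_lt.le
  have hlq : 0 ≤ Real.log q := Real.log_nonneg hq1
  set Z := (q ^ 4) ^ k with hZ
  set f := (trunc (q ^ 4) lamC) ^ k with hf
  have hl : Real.log (Z : ℝ) = 4 * k * Real.log q := by
    rw [hZ]; push_cast; rw [← pow_mul, Real.log_pow]; push_cast; ring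
  have e1 : ∀ χ : DirichletCharacter ℂ q, ‖Tw χ (q ^ 4) lamC‖ ^ (2 * k) = ‖Tw χ Z f‖ ^ 2 := by
    intro χ
    rw [← Tw_pow, norm_pow, ← pow_mul, mul_comm]
  rw [sum_congr rfl fun χ _ => e1 χ]
  have mv := mean_value hq Z f ((4 * k * Real.log q) ^ k) (fun n hn => by
    refine (truncpow_norm _ _ _).trans ((vK_le k n).trans ?_)
    rw [← hl]
    obtain ⟨h1, h2⟩ := mem_Ioc.1 hn
    exact pow_le_pow_left₀ (Real.log_natCast_nonneg _)
      (Real.log_le_log (by exact_mod_cast h1) (by exact_mod_cast h2)) _)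
  rw [hl] at mv
  set S := ∑ n ∈ Ioc 0 Z with ¬ q ∣ n, ‖f n‖ ^ 2 / (n : ℝ) ^ 2 with hS
  have hS1 : S ≤ momentConst k := by
    calc S ≤ ∑ n ∈ Ioc 0 Z with ¬ q ∣ n, mT k n := by
          refine sum_le_sum fun n _ => ?_
          unfold mT
          gcongr
          exact truncpow_norm _ _ _
      _ ≤ _ := (mT_summable k).sum_le_tsum _ fun n _ => mT_nonneg k n
  have hqZ : q ≤ Z := by
    rw [hZ, ← pow_mul]; exact Nat.le_self_pow (by omega) q
  have hS2 : ∑ n ∈ range q, mT k n ≤ S := by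
    calc ∑ n ∈ range q, mT k n = ∑ n ∈ Ioo 0 q, mT k n := by
          symm
          refine sum_subset (fun n hn => mem_range.2 (mem_Ioo.1 hn).2) fun n hn hn' => ?_
          have : n = 0 := by
            simp only [mem_range, mem_Ioo] at hn hn'; omega
          subst this; unfold mT; simp
      _ = ∑ n ∈ Ioo 0 q, ‖f n‖ ^ 2 / (n : ℝ) ^ 2 := by
          refine sum_congr rfl fun n hn => ?_
          have hn' : n ≤ q ^ 4 := (mem_Ioo.1 hn).2.le.trans (Nat.le_self_pow (by norm_num) q)
          rw [hf, truncpow_eq _ _ _ hn', Complex.norm_real, Real.norm_eq_abs, sq_abs]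
          rfl
      _ ≤ S := by
          refine sum_le_sum_of_subset_of_nonneg (fun n hn => ?_) fun n _ _ => by positivity
          obtain ⟨h1, h2⟩ := mem_Ioo.1 hn
          exact mem_filter.2 ⟨mem_Ioc.2 ⟨h1, h2.le.trans hqZ⟩, Nat.not_dvd_of_pos_of_lt h1 h2⟩
  have h3 := HC q hq.one_lt.le
  have h4 := HC' q hq1
  have h5 : 2 * ((4 * k * Real.log q) ^ k) ^ 2 * (1 + 4 * k * Real.log q) ^ 2 ≤
      2 * (1 + 4 * k * Real.log q) ^ (2 * k + 2) := by
    rw [pow_add, ← mul_assoc, ← pow_mul, mul_comm k 2]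
    gcongr
    linarith
  have h6 : |((q : ℝ) - 1) * S - ((q : ℝ) - 1) * momentConst k| ≤ C * (q : ℝ) ^ (1 / 2 : ℝ) := by
    rw [abs_le]
    constructor
    · have : ((q : ℝ) - 1) * (momentConst k - S) ≤ q * (momentConst k - ∑ n ∈ range q, mT k n) := by
        gcongr
        linarith
      linarith
    · have : 0 ≤ ((q : ℝ) - 1) * (momentConst k - S) := mul_nonneg (by linarith) (by linarith)
      have : 0 ≤ C * (q : ℝ) ^ (1 / 2 : ℝ) := by positivity
      linarith
  refine (abs_sub_le _ (((q : ℝ) - 1) * S) _).trans ?_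
  linarith

lemma P_bound (η : ℝ) (hη : 0 < η) : ∃ C : ℝ, 0 < C ∧ ∀ (q : ℕ) [NeZero q], q.Prime →
    ∀ χ : DirichletCharacter ℂ q, ‖Tw χ (q ^ 4) lamC‖ ≤ C * (q : ℝ) ^ η := by
  obtain ⟨C', hC', HC'⟩ := log_le_pow η hη 2 4 (by norm_num)
  refine ⟨C', hC', fun q _ hq χ => ?_⟩
  have hq1 : (1 : ℝ) ≤ q := by exact_mod_cast hq.one_lt.le
  have hlq : 0 ≤ Real.log q := Real.log_nonneg hq1
  have hl : Real.log ((q ^ 4 : ℕ) : ℝ) = 4 * Real.log q := by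
    push_cast; rw [Real.log_pow]; norm_num
  refine (Tw_norm χ (q ^ 4) lamC (4 * Real.log q) (by positivity) (fun n hn => ?_)).trans ?_
  · obtain ⟨h1, h2⟩ := mem_Ioc.1 hn
    rw [lamC_apply, Complex.norm_real, Real.norm_eq_abs, abs_of_nonneg vonMangoldt_nonneg, ← hl]
    exact vonMangoldt_le_log.trans
      (Real.log_le_log (by exact_mod_cast h1) (by exact_mod_cast h2))
  · rw [hl]
    refine le_trans ?_ (HC' q hq1)
    nlinarith

lemma D_approx (η : ℝ) (hη : 0 < η) : ∃ C : ℝ, 0 < C ∧ ∀ (q : ℕ) [NeZero q], q.Prime →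
    ∑ χ : DirichletCharacter ℂ q with χ ≠ 1,
      ‖logDeriv (DirichletCharacter.LFunction χ) 1 + Tw χ (q ^ 4) lamC‖ ^ 2 ≤ C * (q : ℝ) ^ η := by
  obtain ⟨C, hC, HC⟩ := mollify (η / 3) (by positivity)
  obtain ⟨C', hC', HC'⟩ := logDeriv_bound (η / 3) (by positivity)
  refine ⟨2 * C + 2 * C' ^ 2 * C, by positivity, fun q _ hq => ?_⟩
  have hq1 : (1 : ℝ) ≤ q := by exact_mod_cast hq.one_lt.le
  obtain ⟨h1, h2⟩ := HC q hq
  calc _ ≤ ∑ χ : DirichletCharacter ℂ q with χ ≠ 1,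
        (2 * ‖deriv (DirichletCharacter.LFunction χ) 1 * Tw χ (q ^ 4) muC + Tw χ (q ^ 4) lamC‖ ^ 2 +
          2 * (C' * (q : ℝ) ^ (η / 3)) ^ 2 *
            ‖DirichletCharacter.LFunction χ 1 * Tw χ (q ^ 4) muC - 1‖ ^ 2) := by
        refine sum_le_sum fun χ hχ => ?_
        have hχ1 := (mem_filter.1 hχ).2
        have hL := DirichletCharacter.LFunction_apply_one_ne_zero hχ1
        have hD := HC' q hq χ hχ1
        have e : logDeriv (DirichletCharacter.LFunction χ) 1 * DirichletCharacter.LFunction χ 1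
            = deriv (DirichletCharacter.LFunction χ) 1 := by
          rw [logDeriv_apply, div_mul_cancel₀ _ hL]
        rw [← e]
        set D := logDeriv (DirichletCharacter.LFunction χ) 1
        set L := DirichletCharacter.LFunction χ 1
        set M := Tw χ (q ^ 4) muC
        set P := Tw χ (q ^ 4) lamC
        have e2 : D + P = (D * L * M + P) - D * (L * M - 1) := by ring
        have e3 : ‖D + P‖ ≤ ‖D * L * M + P‖ + ‖D‖ * ‖L * M - 1‖ := by
          rw [e2, ← norm_mul]; exact norm_sub_le _ _
        have e4 : ‖D + P‖ ≤ ‖D * L * M + P‖ + C' * (q : ℝ) ^ (η / 3) * ‖L * M - 1‖ := by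
          refine e3.trans ?_; gcongr
        have e5 : ‖D + P‖ ^ 2 ≤ (‖D * L * M + P‖ + C' * (q : ℝ) ^ (η / 3) * ‖L * M - 1‖) ^ 2 := by
          gcongr
        nlinarith [sq_nonneg (‖D * L * M + P‖ - C' * (q : ℝ) ^ (η / 3) * ‖L * M - 1‖)]
    _ ≤ 2 * (C * (q : ℝ) ^ (η / 3)) + 2 * (C' * (q : ℝ) ^ (η / 3)) ^ 2 * (C * (q : ℝ) ^ (η / 3)) := by
        rw [sum_add_distrib, ← mul_sum, ← mul_sum]; gcongr
    _ = 2 * C * (q : ℝ) ^ (η / 3) + 2 * C' ^ 2 * C *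
        ((q : ℝ) ^ (η / 3) * (q : ℝ) ^ (η / 3) * (q : ℝ) ^ (η / 3)) := by ring
    _ = 2 * C * (q : ℝ) ^ (η / 3) + 2 * C' ^ 2 * C * (q : ℝ) ^ η := by
        rw [← Real.rpow_add (by linarith), ← Real.rpow_add (by linarith)]; ring_nf
    _ ≤ 2 * C * (q : ℝ) ^ η + 2 * C' ^ 2 * C * (q : ℝ) ^ η := by
        gcongr
        linarith
    _ = _ := by ring

lemma moment_diff (k : ℕ) (hk : 1 ≤ k) : ∃ C : ℝ, 0 < C ∧ ∀ (q : ℕ) [NeZero q], q.Prime →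
    |∑ χ : DirichletCharacter ℂ q with χ ≠ 1, ‖logDeriv (DirichletCharacter.LFunction χ) 1‖ ^ (2 * k) -
      ∑ χ : DirichletCharacter ℂ q with χ ≠ 1, ‖Tw χ (q ^ 4) lamC‖ ^ (2 * k)|
      ≤ C * (q : ℝ) ^ (9 / 10 : ℝ) := by
  have hk0 : (0 : ℝ) < k := by exact_mod_cast hk
  obtain ⟨C1, hC1, HC1⟩ := logDeriv_bound (1 / (10 * k)) (by positivity)
  obtain ⟨C2, hC2, HC2⟩ := P_bound (1 / (10 * k)) (by positivity)
  obtain ⟨C3, hC3, HC3⟩ := D_approx (1 / 5) (by norm_num)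
  set K := max (max C1 C2) 1 with hK
  have hK1 : C1 ≤ K := (le_max_left _ _).trans (le_max_left _ _)
  have hK2 : C2 ≤ K := (le_max_right _ _).trans (le_max_left _ _)
  have hK3 : 1 ≤ K := le_max_right _ _
  refine ⟨2 * k * K ^ (2 * k) * √C3, by positivity, fun q _ hq => ?_⟩
  have hq1 : (1 : ℝ) ≤ q := by exact_mod_cast hq.one_lt.le
  have hq0 : (0 : ℝ) < q := by linarith
  set X : ℝ := K * (q : ℝ) ^ (1 / (10 * k : ℝ)) with hX
  have hX1 : 1 ≤ X := by
    have : 1 ≤ (q : ℝ) ^ (1 / (10 * k : ℝ)) := Real.one_le_rpow hq1 (by positivity)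
    nlinarith
  have hXp : X ^ (2 * k) = K ^ (2 * k) * (q : ℝ) ^ (1 / 5 : ℝ) := by
    rw [hX, mul_pow, ← Real.rpow_natCast (_ ^ _) (2 * k), ← Real.rpow_mul (by linarith)]
    congr 2
    push_cast; field_simp; norm_num
  set T := ∑ χ : DirichletCharacter ℂ q with χ ≠ 1,
      ‖logDeriv (DirichletCharacter.LFunction χ) 1 + Tw χ (q ^ 4) lamC‖ with hT
  have hT2 : T ≤ √C3 * (q : ℝ) ^ (3 / 5 : ℝ) := by
    refine le_of_sq_le_sq ?_ (by positivity)
    calc T ^ 2 ≤ _ := sq_sum_le_card_mul_sum_sq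
      _ ≤ (q : ℝ) * (C3 * (q : ℝ) ^ (1 / 5 : ℝ)) := by
          refine mul_le_mul ?_ (HC3 q hq) (sum_nonneg fun _ _ => by positivity) hq0.le
          refine le_trans ?_ (card_char q)
          exact_mod_cast card_le_card (filter_subset _ _)
      _ = C3 * ((q : ℝ) ^ (1 : ℝ) * (q : ℝ) ^ (1 / 5 : ℝ)) := by rw [Real.rpow_one]; ring
      _ = (√C3 * (q : ℝ) ^ (3 / 5 : ℝ)) ^ 2 := by
          rw [mul_pow, Real.sq_sqrt hC3.le, ← Real.rpow_add hq0, ← Real.rpow_natCast (_ ^ _) 2,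
            ← Real.rpow_mul hq0.le]
          norm_num
  rw [← sum_sub_distrib]
  refine (abs_sum_le_sum_abs _ _).trans ?_
  calc _ ≤ ∑ χ : DirichletCharacter ℂ q with χ ≠ 1, 2 * k * X ^ (2 * k) *
        ‖logDeriv (DirichletCharacter.LFunction χ) 1 + Tw χ (q ^ 4) lamC‖ := by
        refine sum_le_sum fun χ hχ => ?_
        have hχ1 := (mem_filter.1 hχ).2
        refine (abs_pow_sub_pow_le _ _ _).trans ?_
        have h1 : ‖logDeriv (DirichletCharacter.LFunction χ) 1‖ ≤ X :=
          (HC1 q hq χ hχ1).trans (by rw [hX]; gcongr)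
        have h2 : ‖Tw χ (q ^ 4) lamC‖ ≤ X := (HC2 q hq χ).trans (by rw [hX]; gcongr)
        rw [abs_of_nonneg (norm_nonneg (logDeriv _ _)), abs_of_nonneg (norm_nonneg (Tw _ _ _))]
        have h3 : max ‖logDeriv (DirichletCharacter.LFunction χ) 1‖ ‖Tw χ (q ^ 4) lamC‖ ^ (2 * k - 1)
            ≤ X ^ (2 * k) :=
          (pow_le_pow_left₀ (le_max_of_le_left (norm_nonneg _)) (max_le h1 h2) _).trans
            (pow_le_pow_right₀ hX1 (by omega))
        have h4 : |‖logDeriv (DirichletCharacter.LFunction χ) 1‖ - ‖Tw χ (q ^ 4) lamC‖| ≤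
            ‖logDeriv (DirichletCharacter.LFunction χ) 1 + Tw χ (q ^ 4) lamC‖ := by
          have := abs_norm_sub_norm_le (logDeriv (DirichletCharacter.LFunction χ) 1) (-Tw χ (q ^ 4) lamC)
          rwa [norm_neg, sub_neg_eq_add] at this
        push_cast
        calc _ ≤ ‖logDeriv (DirichletCharacter.LFunction χ) 1 + Tw χ (q ^ 4) lamC‖ * (2 * k) *
              X ^ (2 * k) := by gcongr
          _ = _ := by ring
    _ = 2 * k * X ^ (2 * k) * T := by rw [← mul_sum]
    _ ≤ 2 * k * (K ^ (2 * k) * (q : ℝ) ^ (1 / 5 : ℝ)) * (√C3 * (q : ℝ) ^ (3 / 5 : ℝ)) := by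
        rw [hXp]; gcongr
    _ = 2 * k * K ^ (2 * k) * √C3 * ((q : ℝ) ^ (1 / 5 : ℝ) * (q : ℝ) ^ (3 / 5 : ℝ)) := by ring
    _ ≤ _ := by
        rw [← Real.rpow_add hq0]
        gcongr
        norm_num

lemma charMomentSum_eq (q k : ℕ) [NeZero q] (hq : 2 ≤ q) : charMomentSum q k =
    ∑ χ : DirichletCharacter ℂ q with χ ≠ 1,
      ‖logDeriv (DirichletCharacter.LFunction χ) 1‖ ^ (2 * k) := by
  unfold charMomentSum
  rw [dif_pos hq, sum_filter]
  

end MomentProof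

open MomentProof

/-- For every integer `k ≥ 1` and every `ε > 0` there is a
constant `C = C(ε, k)` such that for every odd prime `q`,
`∑_{χ ≠ χ₀ mod q} |L'/L(1,χ)|^{2k} = (q-2) ∑_{m ≥ 1} (Λ^{*k}(m))²/m²
  + O_{ε,k}(q^{9/10+ε})`. -/
theorem moment_asymptotic (k : ℕ) (hk : 1 ≤ k) (ε : ℝ) (hε : 0 < ε) :
    ∃ C : ℝ, ∀ q : ℕ, q.Prime → Odd q →
      |charMomentSum q k - ((q : ℝ) - 2) * momentConst k| ≤
        C * (q : ℝ) ^ ((9 : ℝ) / 10 + ε) := by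
  obtain ⟨C1, hC1, HC1⟩ := moment_diff k hk
  obtain ⟨C2, hC2, HC2⟩ := P_moment k hk
  have hk0 : (0 : ℝ) < k := by exact_mod_cast hk
  obtain ⟨C3, hC3, HC3⟩ := P_bound (1 / (10 * k)) (by positivity)
  have hM : 0 ≤ momentConst k := tsum_nonneg fun n => mT_nonneg k n
  refine ⟨C1 + C2 + C3 ^ (2 * k) + momentConst k, fun q hq _ => ?_⟩
  haveI : NeZero q := ⟨hq.ne_zero⟩
  have hq1 : (1 : ℝ) ≤ q := by exact_mod_cast hq.one_lt.le
  have hq0 : (0 : ℝ) < q := by linarith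
  rw [charMomentSum_eq q k hq.two_le]
  have h1 := HC1 q hq
  have h2 := HC2 q hq
  have h3 : ‖Tw (1 : DirichletCharacter ℂ q) (q ^ 4) lamC‖ ^ (2 * k) ≤
      C3 ^ (2 * k) * (q : ℝ) ^ (1 / 5 : ℝ) := by
    refine (pow_le_pow_left₀ (norm_nonneg _) (HC3 q hq 1) _).trans (le_of_eq ?_)
    rw [mul_pow, ← Real.rpow_natCast (_ ^ _) (2 * k), ← Real.rpow_mul (by linarith)]
    congr 2
    push_cast; field_simp; norm_num
  have h3' : 0 ≤ ‖Tw (1 : DirichletCharacter ℂ q) (q ^ 4) lamC‖ ^ (2 * k) := by positivity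
  have hsplit : ∑ χ : DirichletCharacter ℂ q, ‖Tw χ (q ^ 4) lamC‖ ^ (2 * k) =
      ‖Tw (1 : DirichletCharacter ℂ q) (q ^ 4) lamC‖ ^ (2 * k) +
      ∑ χ : DirichletCharacter ℂ q with χ ≠ 1, ‖Tw χ (q ^ 4) lamC‖ ^ (2 * k) := by
    classical
    rw [Finset.filter_ne']
    exact (Finset.add_sum_erase _ (fun χ : DirichletCharacter ℂ q => ‖Tw χ (q ^ 4) lamC‖ ^ (2 * k)) (Finset.mem_univ _)).symm
  rw [hsplit] at h2
  have hpow : ∀ a : ℝ, a ≤ 9 / 10 → (q : ℝ) ^ a ≤ (q : ℝ) ^ ((9 : ℝ) / 10 + ε) := fun a ha =>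
    Real.rpow_le_rpow_of_exponent_le hq1 (by linarith)
  have p1 := mul_le_mul_of_nonneg_left (hpow (9 / 10) (by norm_num)) hC1.le
  have p2 := mul_le_mul_of_nonneg_left (hpow (1 / 2) (by norm_num)) hC2.le
  have p3 := mul_le_mul_of_nonneg_left (hpow (1 / 5) (by norm_num)) (pow_nonneg hC3.le (2 * k))
  have p4 := mul_le_mul_of_nonneg_left (Real.one_le_rpow hq1 (show 0 ≤ (9 : ℝ) / 10 + ε by linarith)) hM
  rw [abs_le] at h1 h2 ⊢
  constructor <;> nlinarith
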